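/- For every NPLCS N, location q and sets of locations A₁,B₁,…,Aₙ,Bₙ ⊆ Q, for each i ∈ {1,…,n} let C_i = {z ∈ Q : there is a scheduler W with Pr_W((z,ε) ⊨ □◇Aᵢ ∧ □¬Bᵢ) = 1} and let C = C₁ ∪ … ∪ Cₙ. Then there exists a finite-memory scheduler U with Pr_U((q,ε) ⊨ ⋁_{i=1}^n (□◇Aᵢ ∧ ◇□¬Bᵢ)) = 1 if and only if there exists a scheduler V with Pr_V((q,ε) ⊨ ◇C) = 1. -/

import Mathlib

open scoped ENNReal
open Classical

namespace NPLCSmodel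

/-! ## Lossy channel systems -/

/-- Operations of a lossy channel system: send a message on a channel,
receive a message from a channel, or an internal action. -/
inductive LcsOp (C M : Type) : Type where
  | send : C → M → LcsOp C M
  | recv : C → M → LcsOp C M
  | internal : LcsOp C M

def LcsOp.IsRecv {C M : Type} : LcsOp C M → Prop
  | .recv _ _ => True
  | _ => False

/-- A transition rule `src --op--> dst`. -/
structure LcsRule (Q C M : Type) : Type where
  src : Q
  op : LcsOp C M
  dst : Q

/-- Channel contents: a word over `M` for each channel. -/
abbrev Chans (C M : Type) : Type := C → List M

/-- Configurations: a location together with channel contents. -/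
abbrev Conf (Q C M : Type) : Type := Q × Chans C M

/-- The empty channel contents ε. -/
def eps (C M : Type) : Chans C M := fun _ => []

variable {Q C M : Type}

/-- When is an operation possible on channel contents `w`? -/
def enabledOp : LcsOp C M → Chans C M → Prop
  | .recv c m, w => ∃ v, w c = m :: v
  | .send _ _, _ => True
  | .internal, _ => True

/-- Effect of an operation on the channel contents (for a perfect step). -/
def applyOp [DecidableEq C] : LcsOp C M → Chans C M → Chans C M
  | .send c m, w => Function.update w c (w c ++ [m])
  | .recv c _, w => Function.update w c (w c).tail
  | .internal, w => w

/-- A rule is enabled in a configuration. -/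
def LcsRule.EnabledIn (δ : LcsRule Q C M) (s : Conf Q C M) : Prop :=
  δ.src = s.1 ∧ enabledOp δ.op s.2

/-- A lossy channel system `L = (Q, C, M, Δ)` (the finiteness of the location,
channel and message types is imposed by `Fintype` assumptions at use sites):
a finite set of transition rules such that every location has at least one
outgoing rule that is not a receive. -/
structure LCS (Q C M : Type) : Type where
  rules : Set (LcsRule Q C M)
  finiteRules : rules.Finite
  noDeadlock : ∀ q : Q, ∃ δ ∈ rules, δ.src = q ∧ ¬ δ.op.IsRecv

variable [DecidableEq C]

/-- Lossy step via rule `δ`: a perfect step followed by losing arbitrarily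
many messages (`<+` is the (componentwise) subword relation). -/
def LCS.StepVia (L : LCS Q C M) (s : Conf Q C M) (δ : LcsRule Q C M)
    (t : Conf Q C M) : Prop :=
  δ ∈ L.rules ∧ δ.EnabledIn s ∧ t.1 = δ.dst ∧ ∀ c, List.Sublist (t.2 c) (applyOp δ.op s.2 c)

/-- Lossy step `s → t`. -/
def LCS.Step (L : LCS Q C M) (s t : Conf Q C M) : Prop := ∃ δ, L.StepVia s δ t

/-- Reachability `s →* t`. -/
def LCS.Reach (L : LCS Q C M) : Conf Q C M → Conf Q C M → Prop :=
  Relation.ReflTransGen L.Step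

/-- Constrained reachability `s →*_[X) t`: all configurations along the path,
except possibly the last one, have their location in `X`. -/
def LCS.ReachWithin (L : LCS Q C M) (X : Set Q) : Conf Q C M → Conf Q C M → Prop :=
  Relation.ReflTransGen (fun a b => L.Step a b ∧ a.1 ∈ X)

/-- Constrained reachability `s →*_[X] t`: all configurations along the path,
including `s` and `t`, have their location in `X`. -/
def LCS.ReachConstrained (L : LCS Q C M) (X : Set Q) (s t : Conf Q C M) : Prop :=
  L.ReachWithin X s t ∧ t.1 ∈ X

/-- `X` is safe for `A`. -/
def LCS.IsSafeFor (L : LCS Q C M) (A X : Set Q) : Prop :=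
  X ⊆ A ∧ ∀ x ∈ X, ∃ t, L.Step (x, eps C M) t ∧ t.1 ∈ X

/-- `Safe(A)`: the largest set safe for `A` (the union of all such sets). -/
def LCS.Safe (L : LCS Q C M) (A : Set Q) : Set Q := ⋃₀ {X | L.IsSafeFor A X}

/-- `X` is promising for `A`. -/
def LCS.IsPromisingFor (L : LCS Q C M) (A X : Set Q) : Prop :=
  ∀ x ∈ X, ∃ t, L.ReachWithin X (x, eps C M) t ∧ t.1 ∈ A

/-- `Prom(A)`: the largest set promising for `A` (the union of all such sets). -/
def LCS.Prom (L : LCS Q C M) (A : Set Q) : Set Q := ⋃₀ {X | L.IsPromisingFor A X}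

/-! ## NPLCS and the induced Markov decision process -/

/-- An NPLCS: an LCS together with a fault rate `τ ∈ (0,1)`. -/
structure NPLCS (Q C M : Type) : Type where
  L : LCS Q C M
  τ : ℝ
  τ_pos : 0 < τ
  τ_lt_one : τ < 1

/-- The number of embeddings of the second list as a subword of the first. -/
def countEmb [DecidableEq M] : List M → List M → ℕ
  | _, [] => 1
  | [], _ :: _ => 0
  | a :: v, b :: w => (if a = b then countEmb v w else 0) + countEmb v (b :: w)

variable [Fintype C] [DecidableEq M]

/-- Total number of messages in the channels. -/
def chansSize (w : Chans C M) : ℕ := ∑ c, (w c).length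

/-- `P_lost(v,v') = τ^(|v|-|v'|) · (1-τ)^|v'| · C(v,v')`, the probability that
channel contents `v` become `v'` through message losses. -/
noncomputable def plost (τ : ℝ) (v v' : Chans C M) : ℝ≥0∞ :=
  ENNReal.ofReal
    (τ ^ (chansSize v - chansSize v') * (1 - τ) ^ chansSize v' *
      (∏ c, countEmb (v c) (v' c) : ℕ))

/-- One-step probability `P_N(s, δ, t)` of the MDP of an NPLCS. -/
noncomputable def NPLCS.stepProb (N : NPLCS Q C M) (s : Conf Q C M)
    (δ : LcsRule Q C M) (t : Conf Q C M) : ℝ≥0∞ :=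
  if δ ∈ N.L.rules ∧ δ.EnabledIn s ∧ t.1 = δ.dst then
    plost N.τ (applyOp δ.op s.2) t.2
  else 0

/-! ## Probability measure of a countable-state Markov chain

Given one-step probabilities `k` on a state space `S`, the measure of a set of
trajectories is the Carathéodory outer measure generated by the probabilities
of cylinder sets; it agrees with the usual Markov-chain measure on all
measurable (in particular, on all ω-regular) sets of trajectories. -/

section Chain
variable {S : Type}

/-- Probability that the chain starting in `s` performs the finite sequence
of steps through the configurations listed in `l`. -/
noncomputable def chainPathProb (k : S → S → ℝ≥0∞) : S → List S → ℝ≥0∞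
  | _, [] => 1
  | s, t :: l => k s t * chainPathProb k t l

/-- The cylinder of trajectories starting with `s` followed by `l`. -/
def chainCyl (s : S) (l : List S) : Set (ℕ → S) :=
  {ω | ω 0 = s ∧ ∀ (i : ℕ) (h : i < l.length), ω (i + 1) = l.get ⟨i, h⟩}

/-- Premeasure: probability of a cylinder set, `∞` on other (nonempty) sets. -/
noncomputable def chainFun (k : S → S → ℝ≥0∞) (s : S) (A : Set (ℕ → S)) : ℝ≥0∞ :=
  if A = ∅ then 0 else ⨅ (l : List S) (_ : A = chainCyl s l), chainPathProb k s l

theorem chainFun_empty (k : S → S → ℝ≥0∞) (s : S) : chainFun k s ∅ = 0 := by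
  simp [chainFun]

/-- The probability, for the Markov chain with one-step probabilities `k`
started in `s`, of the set `E` of trajectories (paths starting in `s`). -/
noncomputable def chainPr (k : S → S → ℝ≥0∞) (s : S) (E : Set (ℕ → S)) : ℝ≥0∞ :=
  MeasureTheory.OuterMeasure.ofFunction (chainFun k s) (chainFun_empty k s)
    (E ∩ {ω | ω 0 = s})

end Chain

/-! ## Schedulers -/

/-- A (history-dependent, deterministic) scheduler: given the history
`h = s₁ → ⋯ → s_{n-1}` and the current configuration `sₙ`, it chooses a
transition rule of `N` enabled in `sₙ`. -/
structure Scheduler (N : NPLCS Q C M) : Type where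
  choose : List (Conf Q C M) → Conf Q C M → LcsRule Q C M
  choose_mem : ∀ h s, choose h s ∈ N.L.rules
  choose_enabled : ∀ h s, (choose h s).EnabledIn s

variable {N : NPLCS Q C M}

/-- The Markov chain `MC_U` induced by a scheduler: its states are finite
paths, represented as (history, current configuration). -/
noncomputable def Scheduler.kernel (U : Scheduler N) :
    List (Conf Q C M) × Conf Q C M → List (Conf Q C M) × Conf Q C M → ℝ≥0∞ :=
  fun a b =>
    if b.1 = a.1 ++ [a.2] then N.stepProb a.2 (U.choose a.1 a.2) b.2 else 0

/-- `Pr_U(s ⊨ E)`: the probability, under scheduler `U` with starting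
configuration `s`, of the set `E` of infinite paths (trajectories of
configurations). -/
noncomputable def Scheduler.Pr (U : Scheduler N) (s : Conf Q C M)
    (E : Set (ℕ → Conf Q C M)) : ℝ≥0∞ :=
  chainPr U.kernel ([], s) {ω | (fun i => (ω i).2) ∈ E}

/-- Memoryless scheduler: the decision depends only on the current
configuration. -/
def Scheduler.Memoryless (U : Scheduler N) : Prop :=
  ∀ h h' s, U.choose h s = U.choose h' s

/-- Blind scheduler: the decision depends only on the sequence of locations
that have been visited. -/
def Scheduler.Blind (U : Scheduler N) : Prop :=
  ∀ h h' s s', h.map Prod.fst = h'.map Prod.fst → s.1 = s'.1 →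
    U.choose h s = U.choose h' s'

/-- Finite-memory scheduler data: finitely many modes, a starting mode, a
decision rule and a next-mode function. -/
structure FMScheduler (N : NPLCS Q C M) : Type 1 where
  Mode : Type
  modeFin : Fintype Mode
  init : Mode
  D : Mode → Conf Q C M → LcsRule Q C M
  upd : Mode → Conf Q C M → Mode
  D_mem : ∀ u s, D u s ∈ N.L.rules
  D_enabled : ∀ u s, (D u s).EnabledIn s

/-- A scheduler is finite-memory if it is induced by finite-memory data. -/
def Scheduler.FiniteMemory (U : Scheduler N) : Prop :=
  ∃ fm : FMScheduler N, ∀ h s, U.choose h s = fm.D (h.foldl fm.upd fm.init) s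

/-- The Markov chain `MC_U` of a finite-memory scheduler: states are pairs
`s_u` of a configuration `s` and a mode `u`. -/
noncomputable def FMScheduler.kernel (fm : FMScheduler N) :
    Conf Q C M × fm.Mode → Conf Q C M × fm.Mode → ℝ≥0∞ :=
  fun a b =>
    if b.2 = fm.upd a.2 a.1 then N.stepProb a.1 (fm.D a.2 a.1) b.1 else 0

/-- Probability measure of the Markov chain `MC_U` of a finite-memory
scheduler, over trajectories of (configuration, mode) states. -/
noncomputable def FMScheduler.PrMC (fm : FMScheduler N)
    (a : Conf Q C M × fm.Mode) (E : Set (ℕ → Conf Q C M × fm.Mode)) : ℝ≥0∞ :=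
  chainPr fm.kernel a E

/-- Reachability in the Markov chain `MC_U` of a finite-memory scheduler. -/
def FMScheduler.MCReach (fm : FMScheduler N) :
    Conf Q C M × fm.Mode → Conf Q C M × fm.Mode → Prop :=
  Relation.ReflTransGen (fun a b => 0 < fm.kernel a b)

/-- The history (the first `i` configurations) of a trajectory. -/
def histTo (ω : ℕ → Conf Q C M) (i : ℕ) : List (Conf Q C M) :=
  (List.range i).map ω

/-- Almost blind scheduler: there are a scheduler `W` and a blind scheduler
`V` such that from any starting configuration, almost surely the choices of
`U` along the path agree with those of `W` up to some finite time and with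
those of `V` afterwards. -/
def Scheduler.AlmostBlind (U : Scheduler N) : Prop :=
  ∃ W V : Scheduler N, V.Blind ∧ ∀ s : Conf Q C M,
    U.Pr s {ω | ∃ n : ℕ,
      (∀ i ≤ n, U.choose (histTo ω i) (ω i) = W.choose (histTo ω i) (ω i)) ∧
      (∀ i, n < i → U.choose (histTo ω i) (ω i) = V.choose (histTo ω i) (ω i))} = 1

/-! ## LTL-style events on trajectories -/

/-- `□P` -/
def evAlways {α : Type} (P : α → Prop) : Set (ℕ → α) := {ω | ∀ i, P (ω i)}

/-- `◇P` -/
def evEventually {α : Type} (P : α → Prop) : Set (ℕ → α) := {ω | ∃ i, P (ω i)}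

/-- `□◇P` -/
def evInfOften {α : Type} (P : α → Prop) : Set (ℕ → α) :=
  {ω | ∀ n, ∃ i, n ≤ i ∧ P (ω i)}

/-- `◇□P` -/
def evEvAlways {α : Type} (P : α → Prop) : Set (ℕ → α) :=
  {ω | ∃ n, ∀ i, n ≤ i → P (ω i)}

/-- The atomic proposition "the current location belongs to `A`". -/
def inLoc (A : Set Q) : Conf Q C M → Prop := fun s => s.1 ∈ A


/-! ## The chain measure -/

section ChainMeasure

open MeasureTheory

variable {S : Type}

/-- The states visited by a trajectory at times `1, …, n`. -/
def trajPrefix (ω : ℕ → S) (n : ℕ) : List S := (List.range n).map fun i => ω (i + 1)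

theorem mem_chainCyl_iff {s : S} {l : List S} {ω : ℕ → S} :
    ω ∈ chainCyl s l ↔ ω 0 = s ∧ trajPrefix ω l.length = l := by
  refine and_congr_right fun _ => ?_
  rw [List.ext_get_iff]
  simp [trajPrefix]

theorem take_trajPrefix (ω : ℕ → S) {m n : ℕ} (h : m ≤ n) :
    (trajPrefix ω n).take m = trajPrefix ω m := by
  simp [trajPrefix, ← List.map_take, List.take_range, h]

theorem exists_chainCyl_subset [TopologicalSpace S] {U : Set (ℕ → S)} (hU : IsOpen U)
    {ω : ℕ → S} (hω : ω ∈ U) : ∃ n, chainCyl (ω 0) (trajPrefix ω n) ⊆ U := by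
  obtain ⟨I, u, hu, hI⟩ := isOpen_pi_iff.mp hU ω hω
  refine ⟨I.sup id, fun ω' h' => hI fun i hi => ?_⟩
  have hle : i ≤ I.sup id := Finset.le_sup (f := id) hi
  have : ω' i = ω i := by
    rcases i with _ | i
    · exact h'.1
    · have := h'.2 i (by simp only [trajPrefix, List.length_map, List.length_range]; omega)
      simpa [trajPrefix] using this
  rw [this]
  exact (hu i hi).2

theorem measurableSet_chainCyl [MeasurableSpace S] [DiscreteMeasurableSpace S] (s : S)
    (l : List S) : MeasurableSet (chainCyl s l) := by
  have : chainCyl s l = {ω : ℕ → S | ω 0 = s} ∩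
      ⋂ (i : ℕ) (h : i < l.length), {ω | ω (i + 1) = l.get ⟨i, h⟩} := by
    ext ω; simp [chainCyl]
  rw [this]
  exact (measurable_pi_apply 0 (MeasurableSet.singleton s)).inter
    (MeasurableSet.iInter fun (i : ℕ) => MeasurableSet.iInter fun _ : i < l.length =>
      measurable_pi_apply (i + 1) (MeasurableSet.singleton _))

/-- The Carathéodory outer measure of cylinders coincides with any finite measure that has the
right values on cylinders. -/
theorem chainPr_eq_measure [Countable S] [MeasurableSpace S] [DiscreteMeasurableSpace S]
    (k : S → S → ℝ≥0∞) (s : S) (ν : Measure (ℕ → S)) [IsFiniteMeasure ν]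
    (h : ∀ l, ν (chainCyl s l) = chainPathProb k s l) (h0 : ν {ω | ω 0 ≠ s} = 0)
    (E : Set (ℕ → S)) : chainPr k s E = ν E := by
  apply le_antisymm
  · let _ : TopologicalSpace S := ⊥
    have _ : DiscreteTopology S := ⟨rfl⟩
    refine le_of_forall_gt fun r hr => ?_
    obtain ⟨U, hEU, hUo, hU⟩ := E.exists_isOpen_lt_of_lt r hr
    refine lt_of_le_of_lt ?_ hU
    let J := {l : List S // chainCyl s l ⊆ U ∧ ∀ m < l.length, ¬ chainCyl s (l.take m) ⊆ U}
    have hcov : E ∩ {ω | ω 0 = s} ⊆ ⋃ l : J, chainCyl s l.1 := by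
      rintro ω ⟨hE, hs⟩
      have hex : ∃ n, chainCyl s (trajPrefix ω n) ⊆ U := by
        obtain ⟨n, hn⟩ := exists_chainCyl_subset hUo (hEU hE)
        exact ⟨n, by rwa [← show ω 0 = s from hs]⟩
      refine Set.mem_iUnion.2 ⟨⟨trajPrefix ω (Nat.find hex), Nat.find_spec hex, ?_⟩, ?_⟩
      · intro m hm
        have hm' : m < Nat.find hex := by simpa [trajPrefix] using hm
        rw [take_trajPrefix ω hm'.le]
        exact Nat.find_min hex hm'
      · exact mem_chainCyl_iff.2 ⟨hs, by simp [trajPrefix]⟩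
    have hdisj : Pairwise fun l l' : J => Disjoint (chainCyl s l.1) (chainCyl s l'.1) := by
      have key : ∀ l l' : J, ∀ ω, ω ∈ chainCyl s l.1 → ω ∈ chainCyl s l'.1 →
          ¬ l.1.length < l'.1.length := by
        intro l l' ω hl hl' hlt
        rw [mem_chainCyl_iff] at hl hl'
        apply l'.2.2 _ hlt
        rw [← hl'.2, take_trajPrefix ω (by simpa [trajPrefix] using hlt.le), hl.2]
        exact l.2.1
      intro l l' hne
      refine Set.disjoint_left.2 fun ω hl hl' => hne (Subtype.ext ?_)
      have h1 := key l l' ω hl hl'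
      have h2 := key l' l ω hl' hl
      rw [mem_chainCyl_iff] at hl hl'
      rw [← hl.2, ← hl'.2, show l.1.length = l'.1.length by omega]
    calc chainPr k s E
        ≤ OuterMeasure.ofFunction (chainFun k s) (chainFun_empty k s)
            (⋃ l : J, chainCyl s l.1) := measure_mono hcov
      _ ≤ ∑' l : J, OuterMeasure.ofFunction (chainFun k s) (chainFun_empty k s)
            (chainCyl s l.1) := measure_iUnion_le _
      _ ≤ ∑' l : J, ν (chainCyl s l.1) := by
          refine ENNReal.tsum_le_tsum fun l => (OuterMeasure.ofFunction_le _).trans ?_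
          rw [h, chainFun]
          split_ifs
          · exact zero_le
          · exact iInf_le_of_le l.1 (iInf_le_of_le rfl le_rfl)
      _ = ν (⋃ l : J, chainCyl s l.1) :=
          (measure_iUnion hdisj fun l => measurableSet_chainCyl s l.1).symm
      _ ≤ ν U := measure_mono (Set.iUnion_subset fun l => l.2.1)
  · have h1 : ν E ≤ ν (E ∩ {ω | ω 0 = s}) := by
      calc ν E ≤ ν ((E ∩ {ω | ω 0 = s}) ∪ {ω | ω 0 ≠ s}) :=
            measure_mono fun ω hω => by by_cases hs : ω 0 = s <;> simp [hω, hs]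
        _ ≤ _ := measure_union_le _ _
        _ = _ := by rw [h0, add_zero]
    refine h1.trans ?_
    refine OuterMeasure.le_ofFunction (m_empty := chainFun_empty k s)
      (μ := ν.toOuterMeasure).2 (fun A => ?_) _
    change ν A ≤ _
    rw [chainFun]
    split_ifs with hA
    · simp [hA]
    · refine le_iInf₂ fun l hl => ?_
      rw [hl, h]

/-- The trajectory driven by a family `ξ` of choices of successors. -/
def walk (s : S) (ξ : ℕ × S → S) : ℕ → S
  | 0 => s
  | n + 1 => ξ (n, walk s ξ n)

theorem measurable_walk [Countable S] [MeasurableSpace S] [DiscreteMeasurableSpace S] (s : S) :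
    Measurable (walk s) := by
  refine measurable_pi_lambda _ fun n => ?_
  induction n with
  | zero => exact measurable_const
  | succ n ih =>
    refine measurable_to_countable' fun y => ?_
    have : (fun ξ => walk s ξ (n + 1)) ⁻¹' {y} =
        ⋃ x, (fun ξ => walk s ξ n) ⁻¹' {x} ∩ (fun ξ : ℕ × S → S => ξ (n, x)) ⁻¹' {y} := by
      ext ξ; simp [walk]
    rw [this]
    exact .iUnion fun x => (ih (.singleton x)).inter (measurable_pi_apply _ (.singleton y))

theorem chainPathProb_eq_prod (k : S → S → ℝ≥0∞) (s : S) (l : List S) :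
    chainPathProb k s l =
      ∏ i ∈ Finset.range l.length, k ((s :: l).getD i s) ((s :: l).getD (i + 1) s) := by
  induction l generalizing s with
  | nil => simp [chainPathProb]
  | cons t l ih =>
    rw [chainPathProb, ih, List.length_cons, Finset.prod_range_succ', mul_comm]
    congr 1
    refine Finset.prod_congr rfl fun i hi => ?_
    have hi := Finset.mem_range.1 hi
    simp [List.getD_eq_getElem?_getD, List.getElem?_eq_getElem hi]
    rw [List.getElem?_eq_getElem (by simp; omega)]
    simp

theorem walk_mem_chainCyl_iff (s : S) (ξ : ℕ × S → S) (l : List S) :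
    walk s ξ ∈ chainCyl s l ↔
      ∀ i < l.length, ξ (i, (s :: l).getD i s) = (s :: l).getD (i + 1) s := by
  constructor
  · rintro ⟨-, h⟩
    have hw : ∀ i ≤ l.length, walk s ξ i = (s :: l).getD i s := by
      rintro (_ | i) hi
      · rfl
      · rw [h i hi]; simp [List.getElem?_eq_getElem (show i < l.length from hi)]
    intro i hi
    rw [← hw i hi.le, ← hw (i + 1) hi]
    rfl
  · intro h
    have hw : ∀ i ≤ l.length, walk s ξ i = (s :: l).getD i s := by
      intro i
      induction i with
      | zero => intro; rfl
      | succ i ih =>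
        intro hi
        rw [← h i hi, ← ih (by omega)]
        rfl
    refine ⟨rfl, fun i hi => ?_⟩
    rw [hw _ hi]
    simp [List.getElem?_eq_getElem hi]

theorem exists_chainMeasure [Countable S] [MeasurableSpace S] [DiscreteMeasurableSpace S]
    {k : S → S → ℝ≥0∞} (hk : ∀ s, ∑' t, k s t = 1) (s : S) :
    ∃ ν : Measure (ℕ → S), IsProbabilityMeasure ν ∧
      (∀ l, ν (chainCyl s l) = chainPathProb k s l) ∧ ∀ E, chainPr k s E = ν E := by
  let p : S → PMF S := fun s => ⟨k s, by rw [← hk s]; exact ENNReal.summable.hasSum⟩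
  let μ := Measure.infinitePi fun a : ℕ × S => (p a.2).toMeasure
  have hp : IsProbabilityMeasure (μ.map (walk s)) :=
    Measure.isProbabilityMeasure_map (measurable_walk s).aemeasurable
  have hcyl : ∀ l, μ.map (walk s) (chainCyl s l) = chainPathProb k s l := by
    intro l
    rw [Measure.map_apply (measurable_walk s) (measurableSet_chainCyl s l), chainPathProb_eq_prod]
    have hinj : Set.InjOn (fun i => (i, (s :: l).getD i s))
        (Finset.range l.length : Set ℕ) := fun i _ j _ h => (Prod.ext_iff.1 h).1
    have : walk s ⁻¹' chainCyl s l = Set.pi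
        ((Finset.range l.length).image fun i => (i, (s :: l).getD i s) : Finset (ℕ × S))
        (fun a => {(s :: l).getD (a.1 + 1) s}) := by
      ext ξ
      rw [Set.mem_preimage, walk_mem_chainCyl_iff]
      simp [Set.mem_pi]
    rw [this, Measure.infinitePi_pi _ (fun _ _ => .singleton _), Finset.prod_image hinj]
    refine Finset.prod_congr rfl fun i _ => ?_
    rw [PMF.toMeasure_apply_singleton _ _ (.singleton _)]
    rfl
  refine ⟨μ.map (walk s), hp, hcyl, chainPr_eq_measure k s _ hcyl ?_⟩
  have : {ω : ℕ → S | ω 0 ≠ s} = ((fun ω => ω 0) ⁻¹' {s})ᶜ := rfl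
  rw [Measure.map_apply (measurable_walk s)
    (this ▸ (measurable_pi_apply 0 (.singleton s)).compl)]
  simp [walk]

end ChainMeasure

/-! ## Calculus of trajectory probabilities -/

section ChainCalculus

open MeasureTheory

variable {S : Type}

/-- Borel sets of trajectories over a discrete state space. -/
def MeasEv (E : Set (ℕ → S)) : Prop :=
  @MeasurableSet _ (@MeasurableSpace.pi ℕ (fun _ => S) fun _ => ⊤) E

theorem MeasEv.compl {E : Set (ℕ → S)} (h : MeasEv E) : MeasEv Eᶜ :=
  MeasurableSet.compl h

theorem MeasEv.inter {E F : Set (ℕ → S)} (h : MeasEv E) (h' : MeasEv F) : MeasEv (E ∩ F) :=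
  MeasurableSet.inter h h'

theorem MeasEv.iUnion {ι : Sort*} [Countable ι] {E : ι → Set (ℕ → S)} (h : ∀ i, MeasEv (E i)) :
    MeasEv (⋃ i, E i) :=
  MeasurableSet.iUnion h

theorem MeasEv.iInter {ι : Sort*} [Countable ι] {E : ι → Set (ℕ → S)} (h : ∀ i, MeasEv (E i)) :
    MeasEv (⋂ i, E i) :=
  MeasurableSet.iInter h

theorem MeasEv.coord (P : S → Prop) (i : ℕ) : MeasEv {ω | P (ω i)} := by
  let _ : MeasurableSpace S := ⊤
  exact measurable_pi_apply i (show MeasurableSet {s | P s} from trivial)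

theorem MeasEv.evAlways (P : S → Prop) : MeasEv (evAlways P) := by
  simpa only [NPLCSmodel.evAlways, Set.ofPred_forall] using .iInter fun i => .coord P i

theorem MeasEv.evEventually (P : S → Prop) : MeasEv (evEventually P) := by
  simpa only [NPLCSmodel.evEventually, Set.ofPred_exists] using .iUnion fun i => .coord P i

theorem MeasEv.evInfOften (P : S → Prop) : MeasEv (evInfOften P) := by
  have : NPLCSmodel.evInfOften P = ⋂ n : ℕ, ⋃ i : ℕ, ⋃ _ : n ≤ i, {ω | P (ω i)} := by
    ext ω; simp [NPLCSmodel.evInfOften]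
  rw [this]
  exact .iInter fun n => .iUnion fun i => .iUnion fun _ => .coord P i

theorem MeasEv.evEvAlways (P : S → Prop) : MeasEv (evEvAlways P) := by
  have : NPLCSmodel.evEvAlways P = ⋃ n : ℕ, ⋂ i : ℕ, ⋂ _ : n ≤ i, {ω | P (ω i)} := by
    ext ω; simp [NPLCSmodel.evEvAlways]
  rw [this]
  exact .iUnion fun n => .iInter fun i => .iInter fun _ => .coord P i

theorem MeasEv.comp {T : Type} {E : Set (ℕ → T)} (h : MeasEv E) (f : S → T) :
    MeasEv {ω : ℕ → S | (fun i => f (ω i)) ∈ E} := by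
  let _ : MeasurableSpace S := ⊤
  let _ : MeasurableSpace T := ⊤
  have : Measurable fun (ω : ℕ → S) i => f (ω i) :=
    measurable_pi_lambda _ fun i => measurable_from_top.comp (measurable_pi_apply i)
  exact this h

/-- The trajectory `s, ω 0, ω 1, …`. -/
def consTraj (s : S) (ω : ℕ → S) : ℕ → S
  | 0 => s
  | n + 1 => ω n

theorem measurable_consTraj [MeasurableSpace S] (s : S) : Measurable (consTraj s) :=
  measurable_pi_lambda _ fun
    | 0 => measurable_const
    | n + 1 => measurable_pi_apply n

theorem MeasEv.cons {E : Set (ℕ → S)} (h : MeasEv E) (s : S) :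
    MeasEv {ω | consTraj s ω ∈ E} := by
  let _ : MeasurableSpace S := ⊤
  exact measurable_consTraj s h

theorem MeasEv.shift {E : Set (ℕ → S)} (h : MeasEv E) (n : ℕ) :
    MeasEv {ω : ℕ → S | (fun i => ω (n + i)) ∈ E} := by
  let _ : MeasurableSpace S := ⊤
  have : Measurable fun (ω : ℕ → S) i => ω (n + i) :=
    measurable_pi_lambda _ fun i => measurable_pi_apply (n + i)
  exact this h

theorem consTraj_mem_chainCyl {s t : S} {l : List S} {ω : ℕ → S} :
    consTraj s ω ∈ chainCyl s (t :: l) ↔ ω ∈ chainCyl t l := by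
  constructor
  · rintro ⟨-, h⟩
    exact ⟨h 0 (by simp), fun i hi => by
      simpa [consTraj] using h (i + 1) (by simpa using hi)⟩
  · rintro ⟨h0, h⟩
    refine ⟨rfl, fun i hi => ?_⟩
    rcases i with _ | i
    · exact h0
    · simpa [consTraj] using h i (by simpa using hi)

variable {k : S → S → ℝ≥0∞}

theorem chainPr_mono_start {s : S} {E F : Set (ℕ → S)}
    (h : ∀ ω ∈ E, ω 0 = s → ω ∈ F) : chainPr k s E ≤ chainPr k s F :=
  measure_mono fun ω hω => ⟨h ω hω.1 hω.2, hω.2⟩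

theorem chainPr_mono {s : S} {E F : Set (ℕ → S)} (h : E ⊆ F) : chainPr k s E ≤ chainPr k s F :=
  chainPr_mono_start fun _ hω _ => h hω

theorem chainPr_congr_start {s : S} {E F : Set (ℕ → S)}
    (h : ∀ ω, ω 0 = s → (ω ∈ E ↔ ω ∈ F)) : chainPr k s E = chainPr k s F :=
  le_antisymm (chainPr_mono_start fun ω hE h0 => (h ω h0).1 hE)
    (chainPr_mono_start fun ω hE h0 => (h ω h0).2 hE)

theorem chainPr_null_of_start {s : S} {E : Set (ℕ → S)} (h : ∀ ω ∈ E, ω 0 ≠ s) :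
    chainPr k s E = 0 := by
  have : E ∩ {ω | ω 0 = s} = ∅ := Set.eq_empty_of_forall_notMem fun ω hω => h ω hω.1 hω.2
  rw [chainPr, this, measure_empty]

theorem chainPr_iUnion_null {ι : Type*} [Countable ι] {s : S} {E : ι → Set (ℕ → S)}
    (h : ∀ i, chainPr k s (E i) = 0) : chainPr k s (⋃ i, E i) = 0 := by
  rw [chainPr, Set.iUnion_inter]
  exact measure_iUnion_null h

theorem chainPr_union_null {s : S} {E F : Set (ℕ → S)}
    (hE : chainPr k s E = 0) (hF : chainPr k s F = 0) : chainPr k s (E ∪ F) = 0 := by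
  rw [chainPr, Set.union_inter_distrib_right]
  exact measure_union_null hE hF

theorem chainPr_null_mono {s : S} {E F : Set (ℕ → S)} (hF : chainPr k s F = 0) (h : E ⊆ F) :
    chainPr k s E = 0 :=
  le_antisymm ((chainPr_mono h).trans_eq hF) zero_le

variable [Countable S]

theorem chainPr_univ (hk : ∀ s, ∑' t, k s t = 1) (s : S) : chainPr k s Set.univ = 1 := by
  let _ : MeasurableSpace S := ⊤
  obtain ⟨ν, _, -, h⟩ := exists_chainMeasure hk s
  rw [h, measure_univ]

theorem chainPr_le_one (hk : ∀ s, ∑' t, k s t = 1) (s : S) (E : Set (ℕ → S)) :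
    chainPr k s E ≤ 1 :=
  (chainPr_mono (Set.subset_univ E)).trans_eq (chainPr_univ hk s)

theorem chainPr_eq_one_iff (hk : ∀ s, ∑' t, k s t = 1) {s : S} {E : Set (ℕ → S)}
    (hE : MeasEv E) : chainPr k s E = 1 ↔ chainPr k s Eᶜ = 0 := by
  let _ : MeasurableSpace S := ⊤
  obtain ⟨ν, _, -, h⟩ := exists_chainMeasure hk s
  rw [h, h, prob_compl_eq_zero_iff hE]

theorem exists_of_chainPr_null (hk : ∀ s, ∑' t, k s t = 1) {s : S} {E : Set (ℕ → S)}
    (hE : chainPr k s E = 0) : ∃ ω, ω 0 = s ∧ ω ∉ E := by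
  by_contra! hcon
  have : chainPr k s Set.univ ≤ chainPr k s E :=
    chainPr_mono_start fun ω _ h0 => hcon ω h0
  rw [hE, chainPr_univ hk] at this
  simp at this

theorem chainPr_chainCyl (hk : ∀ s, ∑' t, k s t = 1) (s : S) (l : List S) :
    chainPr k s (chainCyl s l) = chainPathProb k s l := by
  let _ : MeasurableSpace S := ⊤
  obtain ⟨ν, _, hc, h⟩ := exists_chainMeasure hk s
  rw [h, hc]

/-- First-step decomposition. -/
theorem chainPr_step (hk : ∀ s, ∑' t, k s t = 1) (s : S) {E : Set (ℕ → S)} (hE : MeasEv E) :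
    chainPr k s E = ∑' t, k s t * chainPr k t {ω | consTraj s ω ∈ E} := by
  let _ : MeasurableSpace S := ⊤
  choose ν hp hc h using fun t => exists_chainMeasure hk t
  let μ : Measure (ℕ → S) := Measure.sum fun t => k s t • (ν t).map (consTraj s)
  have hμ : ∀ F, MeasurableSet F → μ F = ∑' t, k s t * chainPr k t {ω | consTraj s ω ∈ F} := by
    intro F hF
    rw [Measure.sum_apply _ hF]
    refine tsum_congr fun t => ?_
    rw [Measure.smul_apply, Measure.map_apply (measurable_consTraj s) hF, smul_eq_mul, h]
    rfl
  have hfin : IsFiniteMeasure μ := by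
    refine ⟨?_⟩
    rw [hμ _ .univ]
    simp [chainPr_univ hk, hk]
  rw [← hμ E hE]
  refine chainPr_eq_measure k s μ (fun l => ?_) ?_ E
  · rw [hμ _ (measurableSet_chainCyl s l)]
    cases l with
    | nil =>
      have : ∀ ω, consTraj s ω ∈ chainCyl s [] := fun ω => ⟨rfl, by simp⟩
      simp [this, chainPr_univ hk, hk, chainPathProb]
    | cons t l =>
      simp only [consTraj_mem_chainCyl, Set.ofPred_mem_eq, chainPathProb]
      rw [tsum_eq_single t, chainPr_chainCyl hk]
      intro u hu
      rw [chainPr_null_of_start fun ω hω h0 => hu (h0.symm.trans hω.1), mul_zero]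
  · rw [hμ _ ((MeasEv.coord (· ≠ s) 0 :))]
    simp only [ENNReal.tsum_eq_zero]
    intro t
    have : chainPr k t {ω | consTraj s ω ∈ {ω | ω 0 ≠ s}} = 0 :=
      chainPr_null_of_start fun ω (hω : consTraj s ω 0 ≠ s) _ => hω rfl
    rw [this, mul_zero]

/-- A chain that is a functional image of another one has the image trajectory distribution. -/
theorem chainPr_map {T : Type} [Countable T] {k' : T → T → ℝ≥0∞} (hk : ∀ s, ∑' t, k s t = 1)
    (f : S → T)
    (hf : ∀ s t', k' (f s) t' = ∑' t, if f t = t' then k s t else 0) (s : S)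
    {E : Set (ℕ → T)} (hE : MeasEv E) :
    chainPr k' (f s) E = chainPr k s {ω | (fun i => f (ω i)) ∈ E} := by
  let _ : MeasurableSpace S := ⊤
  let _ : MeasurableSpace T := ⊤
  have hcyl : ∀ (l : List T) (s : S), chainPr k s {ω | (fun i => f (ω i)) ∈ chainCyl (f s) l} =
      chainPathProb k' (f s) l := by
    intro l
    induction l with
    | nil =>
      intro s
      rw [chainPathProb, ← chainPr_univ hk s]
      exact chainPr_congr_start fun ω h0 => by simp [chainCyl, h0]
    | cons t' l ih =>
      intro s
      rw [chainPr_step hk s (MeasEv.comp (measurableSet_chainCyl _ _) f), chainPathProb, hf,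
        ← ENNReal.tsum_mul_right]
      refine tsum_congr fun t => ?_
      have : ∀ ω : ℕ → S, (fun i => f (consTraj s ω i)) = consTraj (f s) (fun i => f (ω i)) := by
        intro ω; ext (_ | i) <;> rfl
      simp only [Set.mem_ofPred_eq, this, consTraj_mem_chainCyl]
      split_ifs with h
      · rw [← h, ih]
      · rw [chainPr_null_of_start, mul_zero, zero_mul]
        rintro ω hω rfl
        exact h hω.1
  obtain ⟨ν, _, -, h⟩ := exists_chainMeasure hk s
  have hm : Measurable fun (ω : ℕ → S) i => f (ω i) :=
    measurable_pi_lambda _ fun i => measurable_from_top.comp (measurable_pi_apply i)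
  have hF : ∀ F, MeasurableSet F →
      ν.map (fun ω i => f (ω i)) F = chainPr k s {ω | (fun i => f (ω i)) ∈ F} := by
    intro F hF
    rw [Measure.map_apply hm hF, h]
    rfl
  rw [← hF E hE]
  refine chainPr_eq_measure k' (f s) _ (fun l => ?_) ?_ E
  · rw [hF _ (measurableSet_chainCyl _ _), hcyl]
  · rw [hF _ ((MeasEv.coord (· ≠ f s) 0 :))]
    exact chainPr_null_of_start fun ω hω h0 => hω (congrArg f h0)

end ChainCalculus

/-! ## Hitting and recurrence -/

section Recurrence

variable {S : Type} {k : S → S → ℝ≥0∞}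

/-- The probability of never visiting `G`. -/
noncomputable def avoidPr (k : S → S → ℝ≥0∞) (G : Set S) (s : S) : ℝ≥0∞ :=
  chainPr k s (evAlways (· ∉ G))

/-- The probability of not visiting `G` in the first `n` steps. -/
noncomputable def avoidN (k : S → S → ℝ≥0∞) (G : Set S) : ℕ → S → ℝ≥0∞
  | 0, s => if s ∈ G then 0 else 1
  | n + 1, s => if s ∈ G then 0 else ∑' t, k s t * avoidN k G n t

/-- `R` is closed under steps of positive probability. -/
def StepClosed (k : S → S → ℝ≥0∞) (R : Set S) : Prop :=
  ∀ s ∈ R, ∀ t, 0 < k s t → t ∈ R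

theorem stepClosed_reach (a : S) :
    StepClosed k {s | Relation.ReflTransGen (fun x y => 0 < k x y) a s} :=
  fun _ hs _ ht => hs.tail ht

theorem StepClosed.tsum_le {R : Set S} (hR : StepClosed k R) {s : S} (hs : s ∈ R)
    {f g : S → ℝ≥0∞} (hfg : ∀ t ∈ R, f t ≤ g t) :
    ∑' t, k s t * f t ≤ ∑' t, k s t * g t := by
  refine ENNReal.tsum_le_tsum fun t => ?_
  rcases eq_or_ne (k s t) 0 with h | h
  · simp [h]
  · gcongr
    exact hfg t (hR s hs t (pos_iff_ne_zero.2 h))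

theorem avoidPr_of_mem {G : Set S} {s : S} (h : s ∈ G) : avoidPr k G s = 0 :=
  chainPr_null_of_start fun _ hω h0 => hω 0 (h0.symm ▸ h)

theorem tsum_lt_one (hk : ∀ s, ∑' t, k s t = 1) {s t : S} (hst : 0 < k s t) {u : S → ℝ≥0∞}
    (hu : ∀ t, u t ≤ 1)
    (ht : u t < 1) : ∑' t, k s t * u t < 1 := by
  have hsum : ∑' t, k s t * u t + ∑' t, k s t * (1 - u t) = 1 := by
    rw [← ENNReal.tsum_add]
    conv_rhs => rw [← hk s]
    refine tsum_congr fun t => ?_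
    rw [← mul_add, add_tsub_cancel_of_le (hu t), mul_one]
  have hpos : 0 < ∑' t, k s t * (1 - u t) :=
    lt_of_lt_of_le (ENNReal.mul_pos hst.ne' (tsub_pos_of_lt ht).ne') (ENNReal.le_tsum t)
  calc ∑' t, k s t * u t < ∑' t, k s t * u t + ∑' t, k s t * (1 - u t) :=
        ENNReal.lt_add_right (ne_top_of_le_ne_top ENNReal.one_ne_top
          (hsum ▸ le_self_add)) hpos.ne'
    _ = 1 := hsum

variable [Countable S]

theorem avoidN_eq (hk : ∀ s, ∑' t, k s t = 1) (G : Set S) (n : ℕ) (s : S) :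
    avoidN k G n s = chainPr k s {ω | ∀ i ≤ n, ω i ∉ G} := by
  induction n generalizing s with
  | zero =>
    rw [avoidN]
    split_ifs with h
    · refine (chainPr_null_of_start fun ω hω h0 => ?_).symm
      exact hω 0 le_rfl (h0.symm ▸ h)
    · rw [← chainPr_univ hk s]
      refine chainPr_congr_start fun ω h0 => ?_
      simp [h0, h]
  | succ n ih =>
    have hm : MeasEv {ω : ℕ → S | ∀ i ≤ n + 1, ω i ∉ G} := by
      have : {ω : ℕ → S | ∀ i ≤ n + 1, ω i ∉ G} =
          ⋂ i : ℕ, ⋂ _ : i ≤ n + 1, {ω | ω i ∉ G} := by ext; simp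
      rw [this]
      exact .iInter fun i => .iInter fun _ => .coord (· ∉ G) i
    rw [avoidN, chainPr_step hk s hm]
    split_ifs with h
    · refine (ENNReal.tsum_eq_zero.2 fun t => ?_).symm
      have : chainPr k t {ω | consTraj s ω ∈ {ω | ∀ i ≤ n + 1, ω i ∉ G}} = 0 :=
        chainPr_null_of_start fun ω hω _ => hω 0 (by omega) h
      rw [this, mul_zero]
    · refine tsum_congr fun t => ?_
      rw [ih]
      congr 2
      ext ω
      constructor
      · rintro hω (_ | i) hi
        · exact h
        · exact hω i (by omega)
      · intro hω i hi
        exact hω (i + 1) (by omega)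

theorem avoidPr_le_avoidN (hk : ∀ s, ∑' t, k s t = 1) (G : Set S) (n : ℕ) (s : S) :
    avoidPr k G s ≤ avoidN k G n s := by
  rw [avoidN_eq hk]
  exact chainPr_mono fun ω hω i _ => hω i

theorem avoidPr_eq_iInf (hk : ∀ s, ∑' t, k s t = 1) (G : Set S) (s : S) :
    avoidPr k G s = ⨅ n, avoidN k G n s := by
  let _ : MeasurableSpace S := ⊤
  obtain ⟨ν, _, -, h⟩ := exists_chainMeasure hk s
  have : evAlways (· ∉ G) = ⋂ n : ℕ, {ω : ℕ → S | ∀ i ≤ n, ω i ∉ G} := by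
    ext ω
    simp only [evAlways, Set.mem_ofPred_eq, Set.mem_iInter]
    exact ⟨fun h _ i _ => h i, fun h i => h i i le_rfl⟩
  have hm : ∀ n : ℕ, MeasEv {ω : ℕ → S | ∀ i ≤ n, ω i ∉ G} := by
    intro n
    have : {ω : ℕ → S | ∀ i ≤ n, ω i ∉ G} = ⋂ i : ℕ, ⋂ _ : i ≤ n, {ω | ω i ∉ G} := by ext; simp
    rw [this]
    exact .iInter fun i => .iInter fun _ => .coord (· ∉ G) i
  simp only [avoidN_eq hk, avoidPr, h]
  rw [this, Antitone.measure_iInter]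
  · intro m n hmn ω hω i hi
    exact hω i (hi.trans hmn)
  · exact fun n => (hm n).nullMeasurableSet
  · exact ⟨0, MeasureTheory.measure_ne_top _ _⟩

theorem avoidPr_le_one (hk : ∀ s, ∑' t, k s t = 1) (G : Set S) (s : S) : avoidPr k G s ≤ 1 :=
  chainPr_le_one hk s _

theorem avoidPr_step (hk : ∀ s, ∑' t, k s t = 1) {G : Set S} {s : S} (h : s ∉ G) :
    avoidPr k G s = ∑' t, k s t * avoidPr k G t := by
  rw [avoidPr, chainPr_step hk s (.evAlways _)]
  refine tsum_congr fun t => ?_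
  rw [avoidPr]
  congr 2
  ext ω
  constructor
  · exact fun hω i => hω (i + 1)
  · rintro hω (_ | i)
    exacts [h, hω i]

theorem avoidPr_step_le (hk : ∀ s, ∑' t, k s t = 1) (G : Set S) (s : S) :
    avoidPr k G s ≤ ∑' t, k s t * avoidPr k G t := by
  by_cases h : s ∈ G
  · rw [avoidPr_of_mem h]; exact zero_le
  · exact (avoidPr_step hk h).le

theorem avoidPr_lt_one (hk : ∀ s, ∑' t, k s t = 1) {G : Set S} {s g : S}
    (h : Relation.ReflTransGen (fun x y => 0 < k x y) s g) (hg : g ∈ G) :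
    avoidPr k G s < 1 := by
  induction h using Relation.ReflTransGen.head_induction_on with
  | refl => rw [avoidPr_of_mem hg]; exact zero_lt_one
  | head hst _ ih =>
    exact (avoidPr_step_le hk G _).trans_lt (tsum_lt_one hk hst (avoidPr_le_one hk G) ih)

/-- If `F` is hit almost surely and `G` is avoided with probability at most `c < 1` from every
state of `F`, then `G` is hit almost surely. -/
theorem avoidPr_eq_zero_of_attractor (hk : ∀ s, ∑' t, k s t = 1) {R F G : Set S}
    (hR : StepClosed k R) {c : ℝ≥0∞}
    (hc : c < 1) (hF : ∀ s ∈ R, avoidPr k F s = 0)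
    (hG : ∀ s ∈ R, s ∈ F → avoidPr k G s ≤ c) : ∀ s ∈ R, avoidPr k G s = 0 := by
  have h1 : ∀ n, ∀ s ∈ R, avoidPr k G s ≤ c + avoidN k F n s := by
    intro n
    induction n with
    | zero =>
      intro s hs
      by_cases h : s ∈ F
      · exact (hG s hs h).trans le_self_add
      · simp only [avoidN, h, if_false]
        exact (avoidPr_le_one hk G s).trans le_add_self
    | succ n ih =>
      intro s hs
      by_cases h : s ∈ F
      · exact (hG s hs h).trans le_self_add
      · simp only [avoidN, h, if_false]
        calc avoidPr k G s ≤ ∑' t, k s t * avoidPr k G t := avoidPr_step_le hk G s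
          _ ≤ ∑' t, k s t * (c + avoidN k F n t) := hR.tsum_le hs ih
          _ = c + ∑' t, k s t * avoidN k F n t := by
              simp only [mul_add]
              rw [ENNReal.tsum_add, ENNReal.tsum_mul_right, hk, one_mul]
  have h2 : ∀ s ∈ R, avoidPr k G s ≤ c := by
    intro s hs
    calc avoidPr k G s ≤ ⨅ n, (c + avoidN k F n s) := le_iInf fun n => h1 n s hs
      _ = c + avoidPr k F s := by rw [← ENNReal.add_iInf, avoidPr_eq_iInf hk]
      _ = c := by rw [hF s hs, add_zero]
  have h3 : ∀ n, ∀ s ∈ R, avoidPr k G s ≤ c * avoidN k G n s := by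
    intro n
    induction n with
    | zero =>
      intro s hs
      by_cases h : s ∈ G
      · rw [avoidPr_of_mem h]; exact zero_le
      · simpa [avoidN, h] using h2 s hs
    | succ n ih =>
      intro s hs
      by_cases h : s ∈ G
      · rw [avoidPr_of_mem h]; exact zero_le
      · simp only [avoidN, h, if_false]
        calc avoidPr k G s ≤ ∑' t, k s t * avoidPr k G t := avoidPr_step_le hk G s
          _ ≤ ∑' t, k s t * (c * avoidN k G n t) := hR.tsum_le hs ih
          _ = c * ∑' t, k s t * avoidN k G n t := by
              rw [← ENNReal.tsum_mul_left]
              exact tsum_congr fun t => mul_left_comm _ _ _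
  intro s hs
  have h4 : avoidPr k G s ≤ c * avoidPr k G s := by
    calc avoidPr k G s ≤ ⨅ n, c * avoidN k G n s := le_iInf fun n => h3 n s hs
      _ = c * avoidPr k G s := by
          rw [avoidPr_eq_iInf hk, ENNReal.mul_iInf (fun h => absurd h hc.ne_top)]
  by_contra hne
  have hlt : c * avoidPr k G s < 1 * avoidPr k G s :=
    ENNReal.mul_lt_mul_left hne
      (ne_top_of_le_ne_top ENNReal.one_ne_top (avoidPr_le_one hk G s)) hc
  rw [one_mul] at hlt
  exact absurd h4 (not_le.2 hlt)

theorem chainPr_shift_null (hk : ∀ s, ∑' t, k s t = 1) {R : Set S} (hR : StepClosed k R)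
    {E : Set (ℕ → S)} (hE : MeasEv E)
    (h : ∀ s ∈ R, chainPr k s E = 0) (n : ℕ) :
    ∀ s ∈ R, chainPr k s {ω | (fun i => ω (n + i)) ∈ E} = 0 := by
  induction n with
  | zero =>
    simp only [zero_add]
    exact h
  | succ n ih =>
    intro s hs
    rw [chainPr_step hk s (hE.shift _), ENNReal.tsum_eq_zero]
    intro t
    rcases eq_or_ne (k s t) 0 with h0 | h0
    · rw [h0, zero_mul]
    · have : {ω : ℕ → S | consTraj s ω ∈ {ω | (fun i => ω (n + 1 + i)) ∈ E}} =
          {ω | (fun i => ω (n + i)) ∈ E} := by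
        ext ω
        simp only [Set.mem_ofPred_eq, show ∀ i, n + 1 + i = n + i + 1 by intro; omega, consTraj]
      rw [this, ih t (hR s hs t (pos_iff_ne_zero.2 h0)), mul_zero]

theorem chainPr_evInfOften_compl (hk : ∀ s, ∑' t, k s t = 1) {R G : Set S} (hR : StepClosed k R)
    (h : ∀ s ∈ R, avoidPr k G s = 0) {s : S} (hs : s ∈ R) :
    chainPr k s (evInfOften (· ∈ G))ᶜ = 0 := by
  refine chainPr_null_mono (chainPr_iUnion_null fun n =>
    chainPr_shift_null hk hR (.evAlways (· ∉ G)) h n s hs) fun ω hω => ?_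
  simp only [evInfOften, Set.mem_compl_iff, Set.mem_ofPred_eq, not_forall, not_exists,
    not_and] at hω
  obtain ⟨n, hn⟩ := hω
  exact Set.mem_iUnion.2 ⟨n, fun i => hn (n + i) (by omega)⟩

/-- Almost surely, only steps of positive probability are taken. -/
theorem chainPr_evAlways_step_compl (hk : ∀ s, ∑' t, k s t = 1) (s : S) :
    chainPr k s {ω | ∀ i, 0 < k (ω i) (ω (i + 1))}ᶜ = 0 := by
  have hm : MeasEv {ω : ℕ → S | k (ω 0) (ω 1) = 0} := by
    have : {ω : ℕ → S | k (ω 0) (ω 1) = 0} =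
        ⋃ x, ({ω | ω 0 = x} ∩ {ω | k x (ω 1) = 0}) := by ext; simp
    rw [this]
    exact .iUnion fun x => (MeasEv.coord (· = x) 0).inter (MeasEv.coord (k x · = 0) 1)
  have h0 : ∀ s ∈ Set.univ, chainPr k s {ω : ℕ → S | k (ω 0) (ω 1) = 0} = 0 := by
    intro s _
    rw [chainPr_step hk s hm, ENNReal.tsum_eq_zero]
    intro t
    rcases eq_or_ne (k s t) 0 with h | h
    · rw [h, zero_mul]
    · have : chainPr k t {ω | consTraj s ω ∈ {ω | k (ω 0) (ω 1) = 0}} = 0 :=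
        chainPr_null_of_start fun ω hω h0 => h (by rw [← h0]; exact hω)
      rw [this, mul_zero]
  refine chainPr_null_mono (chainPr_iUnion_null fun n =>
    chainPr_shift_null hk (fun _ _ _ _ => trivial) hm h0 n s trivial) fun ω hω => ?_
  simpa using hω

theorem chainPr_null_succ (hk : ∀ s, ∑' t, k s t = 1) {s t : S} (hst : 0 < k s t)
    {E : Set (ℕ → S)} (hE : MeasEv E)
    (h : chainPr k s E = 0) (hcons : ∀ ω ∈ E, consTraj s ω ∈ E) : chainPr k t E = 0 := by
  rw [chainPr_step hk s hE, ENNReal.tsum_eq_zero] at h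
  exact chainPr_null_mono ((mul_eq_zero.1 (h t)).resolve_left hst.ne') hcons

/-- A chain with a size function that contracts in expectation and vanishes with a probability
bounded in terms of the current size almost surely reaches size `0`. -/
theorem avoidPr_eq_zero_of_drift (hk : ∀ s, ∑' t, k s t = 1) {τ : ℝ} (h0 : 0 < τ) (h1 : τ < 1)
    (V : S → ℕ)
    (hdrift : ∀ s, ∑' t, k s t * V t ≤ ENNReal.ofReal (1 - τ) * (V s + 1))
    (hzero : ∀ s, ENNReal.ofReal τ ^ (V s + 1) ≤ ∑' t, if V t = 0 then k s t else 0) (s : S) :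
    avoidPr k {t | V t = 0} s = 0 := by
  obtain ⟨K, hK⟩ := exists_nat_ge (2 / τ)
  let ρ := ENNReal.ofReal (1 - τ / 2)
  have hρ : ρ < 1 := by
    rw [← ENNReal.ofReal_one]
    exact (ENNReal.ofReal_lt_ofReal_iff one_pos).2 (by linarith)
  have hcontr : ∀ s, s ∉ {s | V s ≤ K} → ∑' t, k s t * V t ≤ ρ * V s := by
    intro s hs
    refine (hdrift s).trans ?_
    have hs : K < V s := not_le.1 hs
    have hs' : (K : ℝ) < V s := by exact_mod_cast hs
    rw [show ((V s : ℝ≥0∞) + 1) = ENNReal.ofReal (V s + 1) by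
        rw [ENNReal.ofReal_add (by positivity) (by positivity)]; simp,
      show (V s : ℝ≥0∞) = ENNReal.ofReal (V s) by simp,
      ← ENNReal.ofReal_mul (by linarith), ← ENNReal.ofReal_mul (by linarith)]
    apply ENNReal.ofReal_le_ofReal
    have : 2 ≤ V s * τ := by
      have := hK.trans hs'.le
      rwa [div_le_iff₀ h0] at this
    nlinarith
  have hN : ∀ n s, avoidN k {s | V s ≤ K} n s ≤ ρ ^ n * V s := by
    intro n
    induction n with
    | zero =>
      intro s
      rw [avoidN, pow_zero, one_mul]
      split_ifs with h
      · exact zero_le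
      · have h : K < V s := not_le.1 h
        exact_mod_cast (by omega : 1 ≤ V s)
    | succ n ih =>
      intro s
      rw [avoidN]
      split_ifs with h
      · exact zero_le
      · calc ∑' t, k s t * avoidN k {s | V s ≤ K} n t
            ≤ ∑' t, ρ ^ n * (k s t * V t) := by
              refine ENNReal.tsum_le_tsum fun t => ?_
              rw [mul_left_comm]
              gcongr
              exact ih t
          _ = ρ ^ n * ∑' t, k s t * V t := ENNReal.tsum_mul_left
          _ ≤ ρ ^ n * (ρ * V s) := by gcongr; exact hcontr s h
          _ = ρ ^ (n + 1) * V s := by ring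
  have hF : ∀ s ∈ Set.univ, avoidPr k {s | V s ≤ K} s = 0 := by
    intro s _
    refine le_antisymm (ge_of_tendsto' (x := Filter.atTop) (f := fun n : ℕ => ρ ^ n * V s) ?_
      fun n => (avoidPr_le_avoidN hk _ n s).trans (hN n s)) zero_le
    simpa using ENNReal.Tendsto.mul_const (ENNReal.tendsto_pow_atTop_nhds_zero_of_lt_one hρ)
      (Or.inr (ENNReal.natCast_ne_top (V s)))
  have hτ : ENNReal.ofReal τ ≤ 1 := by
    rw [← ENNReal.ofReal_one]; exact ENNReal.ofReal_le_ofReal h1.le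
  have hτ0 : 0 < ENNReal.ofReal τ := ENNReal.ofReal_pos.2 h0
  refine avoidPr_eq_zero_of_attractor hk (R := Set.univ) (F := {s | V s ≤ K})
    (fun _ _ _ _ => trivial) (c := 1 - ENNReal.ofReal τ ^ (K + 1)) ?_ hF ?_ s trivial
  · exact ENNReal.sub_lt_self ENNReal.one_ne_top one_ne_zero (pow_ne_zero _ hτ0.ne')
  · intro s _ hs
    have hs : V s ≤ K := hs
    have hle : ENNReal.ofReal τ ^ (K + 1) ≤ ∑' t, if V t = 0 then k s t else 0 :=
      (pow_le_pow_right_of_le_one' hτ (by omega)).trans (hzero s)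
    refine ENNReal.le_sub_of_add_le_left (by finiteness) ?_
    calc ENNReal.ofReal τ ^ (K + 1) + avoidPr k {t | V t = 0} s
        ≤ (∑' t, if V t = 0 then k s t else 0) + ∑' t, k s t * avoidPr k {t | V t = 0} t :=
          add_le_add hle (avoidPr_step_le hk _ s)
      _ ≤ ∑' t, k s t := by
          rw [← ENNReal.tsum_add]
          refine ENNReal.tsum_le_tsum fun t => ?_
          by_cases h : V t = 0
          · simp [h, avoidPr_of_mem (show t ∈ {t | V t = 0} from h)]
          · simpa [h] using mul_le_mul_right (avoidPr_le_one hk {t | V t = 0} t) (k s t)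
      _ = 1 := hk s

end Recurrence

/-! ## Message losses -/

section MessageLoss

open MeasureTheory

variable {C M : Type}

theorem chansSize_eq_zero [Fintype C] {v : Chans C M} : chansSize v = 0 ↔ v = eps C M := by
  simp [chansSize, funext_iff, eps]

theorem chansSize_applyOp_le [Fintype C] [DecidableEq C] (op : LcsOp C M) (v : Chans C M) :
    chansSize (applyOp op v) ≤ chansSize v + 1 := by
  have hup : ∀ (c : C) (l : List M), l.length ≤ (v c).length + 1 →
      chansSize (Function.update v c l) ≤ chansSize v + 1 := by
    intro c l hl
    simp only [chansSize]
    rw [← Finset.add_sum_erase _ _ (Finset.mem_univ c),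
      ← Finset.add_sum_erase _ (fun c => (v c).length) (Finset.mem_univ c),
      Function.update_self, Finset.sum_congr rfl fun d hd => by
        rw [Function.update_of_ne (Finset.ne_of_mem_erase hd)]]
    omega
  cases op with
  | send c m => exact hup c _ (by simp)
  | recv c m => exact hup c _ (by simp; omega)
  | internal => exact Nat.le_succ _

variable [DecidableEq M] {τ : ℝ}

theorem countEmb_nil (l : List M) : countEmb l [] = 1 := by cases l <;> rfl

theorem countEmb_pos_iff (l l' : List M) : 0 < countEmb l l' ↔ List.Sublist l' l := by
  induction l generalizing l' with
  | nil => cases l' <;> simp [countEmb]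
  | cons a v ih =>
    cases l' with
    | nil => simp [countEmb]
    | cons b w =>
      rw [countEmb, List.cons_sublist_cons', ← ih, ← ih]
      by_cases h : a = b
      · simp only [h, if_true, true_and]; omega
      · simp [h, Ne.symm h]

/-- The loss probabilities for a single channel. -/
noncomputable def listLoss (τ : ℝ) (l l' : List M) : ℝ≥0∞ :=
  ENNReal.ofReal τ ^ (l.length - l'.length) * ENNReal.ofReal (1 - τ) ^ l'.length * countEmb l l'

theorem listLoss_cons (τ : ℝ) (a : M) (v l' : List M) :
    listLoss τ (a :: v) l' = ENNReal.ofReal τ * listLoss τ v l' +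
      ENNReal.ofReal (1 - τ) * (match l' with
        | [] => 0
        | b :: w => if a = b then listLoss τ v w else 0) := by
  cases l' with
  | nil => simp [listLoss, countEmb_nil, pow_succ, mul_comm]
  | cons b w =>
    have key : ENNReal.ofReal τ ^ (v.length - w.length) * (countEmb v (b :: w) : ℝ≥0∞) =
        ENNReal.ofReal τ * ENNReal.ofReal τ ^ (v.length - (w.length + 1)) *
          (countEmb v (b :: w) : ℝ≥0∞) := by
      rcases Nat.eq_zero_or_pos (countEmb v (b :: w)) with h | h
      · simp [h]
      · have := ((countEmb_pos_iff _ _).1 h).length_le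
        rw [List.length_cons] at this
        rw [← pow_succ', show v.length - (w.length + 1) + 1 = v.length - w.length by omega]
    simp only [listLoss, countEmb, List.length_cons, Nat.add_sub_add_right, Nat.cast_add]
    rw [mul_add, mul_right_comm _ _ (countEmb v (b :: w) : ℝ≥0∞), key]
    split_ifs <;> simp only [pow_succ, Nat.cast_zero, mul_zero] <;> ring

theorem tsum_listLoss_cons (τ : ℝ) (a : M) (v : List M) (f : List M → ℝ≥0∞) :
    ∑' l', listLoss τ (a :: v) l' * f l' = ENNReal.ofReal τ * ∑' l', listLoss τ v l' * f l' +
      ENNReal.ofReal (1 - τ) * ∑' w, listLoss τ v w * f (a :: w) := by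
  simp only [listLoss_cons, add_mul, mul_assoc]
  rw [ENNReal.tsum_add, ENNReal.tsum_mul_left, ENNReal.tsum_mul_left]
  congr 2
  rw [← (List.cons_injective (a := a)).tsum_eq]
  · simp
  · rintro (_ | ⟨b, w⟩) h
    · simp at h
    · by_cases hab : a = b
      · exact ⟨w, by rw [hab]⟩
      · simp [hab] at h

theorem plost_eps [Fintype C] (h0 : 0 < τ) (v : Chans C M) :
    plost τ v (eps C M) = ENNReal.ofReal τ ^ chansSize v := by
  rw [plost, ← ENNReal.ofReal_pow h0.le]
  simp [eps, chansSize, countEmb_nil]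

theorem ofReal_add_ofReal_compl (h0 : 0 < τ) (h1 : τ < 1) :
    ENNReal.ofReal τ + ENNReal.ofReal (1 - τ) = 1 := by
  rw [← ENNReal.ofReal_add h0.le (by linarith)]; simp

theorem tsum_listLoss (h0 : 0 < τ) (h1 : τ < 1) (l : List M) : ∑' l', listLoss τ l l' = 1 := by
  induction l with
  | nil =>
    rw [tsum_eq_single []]
    · simp [listLoss, countEmb_nil]
    · rintro (_ | ⟨b, w⟩) h
      · simp at h
      · simp [listLoss, countEmb]
  | cons a v ih =>
    have := tsum_listLoss_cons τ a v fun _ => 1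
    simp only [mul_one] at this
    rw [this, ih, mul_one, mul_one, ofReal_add_ofReal_compl h0 h1]

theorem tsum_listLoss_length (h0 : 0 < τ) (h1 : τ < 1) (l : List M) :
    ∑' l', listLoss τ l l' * (l'.length : ℝ≥0∞) = ENNReal.ofReal (1 - τ) * l.length := by
  induction l with
  | nil =>
    simp only [List.length_nil, Nat.cast_zero, mul_zero, ENNReal.tsum_eq_zero]
    rintro (_ | ⟨b, w⟩) <;> simp [listLoss, countEmb]
  | cons a v ih =>
    rw [tsum_listLoss_cons]
    simp only [List.length_cons, Nat.cast_add, Nat.cast_one, mul_add, mul_one]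
    rw [ENNReal.tsum_add, ih, tsum_listLoss h0 h1, mul_add, mul_one, ← add_assoc, ← add_mul,
      ofReal_add_ofReal_compl h0 h1, one_mul]

variable [Fintype C]

theorem plost_eq_prod (h0 : 0 < τ) (h1 : τ < 1) (v v' : Chans C M) :
    plost τ v v' = ∏ c, listLoss τ (v c) (v' c) := by
  by_cases hz : ∃ c, countEmb (v c) (v' c) = 0
  · obtain ⟨c, hc⟩ := hz
    rw [plost, Finset.prod_eq_zero (Finset.mem_univ c) hc,
      Finset.prod_eq_zero (Finset.mem_univ c) (by simp [listLoss, hc])]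
    simp
  · have hle : ∀ c, (v' c).length ≤ (v c).length := fun c =>
      ((countEmb_pos_iff _ _).1 (Nat.pos_of_ne_zero fun h => hz ⟨c, h⟩)).length_le
    have h2 : 0 ≤ 1 - τ := by linarith
    simp only [listLoss, plost, chansSize]
    rw [Finset.prod_mul_distrib, Finset.prod_mul_distrib, Finset.prod_pow_eq_pow_sum,
      Finset.prod_pow_eq_pow_sum, Finset.sum_tsub_distrib _ fun c _ => hle c,
      ENNReal.ofReal_mul (by positivity), ENNReal.ofReal_mul (by positivity),
      ENNReal.ofReal_pow h0.le, ENNReal.ofReal_pow h2, ENNReal.ofReal_natCast, Nat.cast_prod]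

theorem plost_pos_iff (h0 : 0 < τ) (h1 : τ < 1) (v v' : Chans C M) :
    0 < plost τ v v' ↔ ∀ c, List.Sublist (v' c) (v c) := by
  have h2 : 0 < 1 - τ := by linarith
  simp only [plost_eq_prod h0 h1, pos_iff_ne_zero, Finset.prod_ne_zero_iff, Finset.mem_univ,
    true_imp_iff, ← countEmb_pos_iff]
  refine forall_congr' fun c => ?_
  simp [listLoss, h0, h1, pow_eq_zero_iff']

variable [Countable M]

theorem exists_lossMeasure (h0 : 0 < τ) (h1 : τ < 1) [MeasurableSpace (List M)]
    [DiscreteMeasurableSpace (List M)]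
    (v : Chans C M) :
    ∃ μ : C → Measure (List M), (∀ c, IsProbabilityMeasure (μ c)) ∧
      (∀ c l, μ c {l} = listLoss τ (v c) l) ∧ ∀ v', plost τ v v' = Measure.pi μ {v'} := by
  let p : C → PMF (List M) := fun c => ⟨listLoss τ (v c), by
    rw [← tsum_listLoss h0 h1 (v c)]; exact ENNReal.summable.hasSum⟩
  have hp : ∀ c l, (p c).toMeasure {l} = listLoss τ (v c) l := fun c l =>
    PMF.toMeasure_apply_singleton _ _ (.singleton _)
  refine ⟨fun c => (p c).toMeasure, fun c => inferInstance, hp, fun v' => ?_⟩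
  rw [Measure.pi_singleton, plost_eq_prod h0 h1]
  exact Finset.prod_congr rfl fun c _ => (hp c _).symm

theorem tsum_plost (h0 : 0 < τ) (h1 : τ < 1) (v : Chans C M) : ∑' v', plost τ v v' = 1 := by
  let _ : MeasurableSpace (List M) := ⊤
  obtain ⟨μ, _, -, h⟩ := exists_lossMeasure h0 h1 v
  have := lintegral_countable' (μ := Measure.pi μ) fun _ => 1
  simp only [one_mul, lintegral_one, measure_univ] at this
  simp only [h, ← this]

theorem tsum_plost_size (h0 : 0 < τ) (h1 : τ < 1) (v : Chans C M) :
    ∑' v', plost τ v v' * (chansSize v' : ℝ≥0∞) = ENNReal.ofReal (1 - τ) * chansSize v := by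
  let _ : MeasurableSpace (List M) := ⊤
  obtain ⟨μ, _, hμ, h⟩ := exists_lossMeasure h0 h1 v
  have hint := lintegral_countable' (μ := Measure.pi μ) fun v' => (chansSize v' : ℝ≥0∞)
  simp only [h, mul_comm (Measure.pi μ _)]
  rw [← hint]
  have hm : ∀ c, Measurable fun v' : C → List M => ((v' c).length : ℝ≥0∞) := fun c =>
    (measurable_from_top (f := fun l : List M => (l.length : ℝ≥0∞))).comp (measurable_pi_apply c)
  simp only [chansSize, Nat.cast_sum, Finset.mul_sum]
  rw [lintegral_finsetSum _ fun c _ => hm c]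
  refine Finset.sum_congr rfl fun c _ => ?_
  rw [(measurePreserving_eval μ c).lintegral_comp
    (measurable_from_top (f := fun l : List M => (l.length : ℝ≥0∞))), lintegral_countable',
    ← tsum_listLoss_length h0 h1]
  exact tsum_congr fun l => by rw [hμ, mul_comm]


end MessageLoss

/-! ## The chains induced by schedulers -/

section SchedulerChains

variable {Q C M : Type}

theorem enabledIn_of_not_isRecv {δ : LcsRule Q C M} {s : Conf Q C M} (hsrc : δ.src = s.1)
    (hrecv : ¬ δ.op.IsRecv) :
    δ.EnabledIn s := by
  refine ⟨hsrc, ?_⟩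
  cases h : δ.op <;> simp_all [enabledOp, LcsOp.IsRecv]

theorem not_isRecv_of_enabledIn_eps {δ : LcsRule Q C M} {z : Q}
    (h : δ.EnabledIn ((z, eps C M) : Conf Q C M)) : ¬ δ.op.IsRecv := by
  have := h.2
  cases hop : δ.op <;> simp_all [enabledOp, LcsOp.IsRecv, eps]

variable [Fintype C] [DecidableEq C] [DecidableEq M] {N : NPLCS Q C M}

theorem stepProb_pos_iff {s : Conf Q C M} {δ : LcsRule Q C M} {t : Conf Q C M} :
    0 < N.stepProb s δ t ↔ N.L.StepVia s δ t := by
  rw [NPLCS.stepProb, LCS.StepVia]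
  split_ifs with h
  · rw [plost_pos_iff N.τ_pos N.τ_lt_one]
    tauto
  · simp only [lt_self_iff_false, false_iff]
    tauto

theorem tsum_stepProb_mul {s : Conf Q C M} {δ : LcsRule Q C M} (hδ : δ ∈ N.L.rules)
    (hs : δ.EnabledIn s) (f : Conf Q C M → ℝ≥0∞) :
    ∑' t, N.stepProb s δ t * f t = ∑' w, plost N.τ (applyOp δ.op s.2) w * f (δ.dst, w) := by
  rw [← (Prod.mk_right_injective (β := Chans C M) δ.dst).tsum_eq]
  · simp [NPLCS.stepProb, hδ, hs]
  · rintro ⟨p, w⟩ h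
    by_cases hp : p = δ.dst
    · exact ⟨w, by rw [hp]⟩
    · simp [NPLCS.stepProb, hp] at h

theorem FMScheduler.tsum_kernel_mul (fm : FMScheduler N) (a : Conf Q C M × fm.Mode)
    (f : Conf Q C M × fm.Mode → ℝ≥0∞) :
    ∑' b, fm.kernel a b * f b =
      ∑' t, N.stepProb a.1 (fm.D a.2 a.1) t * f (t, fm.upd a.2 a.1) := by
  rw [← (Prod.mk_left_injective (α := Conf Q C M) (fm.upd a.2 a.1)).tsum_eq]
  · simp [FMScheduler.kernel]
  · rintro ⟨t, m⟩ h
    by_cases hm : m = fm.upd a.2 a.1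
    · exact ⟨t, by rw [hm]⟩
    · simp [FMScheduler.kernel, hm] at h

theorem Scheduler.tsum_kernel_mul (U : Scheduler N) (a : List (Conf Q C M) × Conf Q C M)
    (f : List (Conf Q C M) × Conf Q C M → ℝ≥0∞) :
    ∑' b, U.kernel a b * f b =
      ∑' t, N.stepProb a.2 (U.choose a.1 a.2) t * f (a.1 ++ [a.2], t) := by
  rw [← (Prod.mk_right_injective (β := Conf Q C M) (a.1 ++ [a.2])).tsum_eq]
  · simp [Scheduler.kernel]
  · rintro ⟨h, t⟩ hh
    by_cases hm : h = a.1 ++ [a.2]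
    · exact ⟨t, by rw [hm]⟩
    · simp [Scheduler.kernel, hm] at hh

theorem FMScheduler.kernel_pos_iff {fm : FMScheduler N} {a b : Conf Q C M × fm.Mode} :
    0 < fm.kernel a b ↔ b.2 = fm.upd a.2 a.1 ∧ N.L.StepVia a.1 (fm.D a.2 a.1) b.1 := by
  rw [FMScheduler.kernel, ← stepProb_pos_iff]
  split_ifs with h <;> simp [h]

theorem Scheduler.kernel_pos_iff {U : Scheduler N} {a b : List (Conf Q C M) × Conf Q C M} :
    0 < U.kernel a b ↔ b.1 = a.1 ++ [a.2] ∧ N.L.StepVia a.2 (U.choose a.1 a.2) b.2 := by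
  rw [Scheduler.kernel, ← stepProb_pos_iff]
  split_ifs with h <;> simp [h]

variable [Countable M]

theorem tsum_stepProb {s : Conf Q C M} {δ : LcsRule Q C M} (hδ : δ ∈ N.L.rules)
    (hs : δ.EnabledIn s) : ∑' t, N.stepProb s δ t = 1 := by
  have := tsum_stepProb_mul hδ hs fun _ => 1
  simpa only [mul_one, tsum_plost N.τ_pos N.τ_lt_one] using this

theorem FMScheduler.tsum_kernel (fm : FMScheduler N) (a : Conf Q C M × fm.Mode) :
    ∑' b, fm.kernel a b = 1 := by
  have := fm.tsum_kernel_mul a fun _ => 1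
  simpa only [mul_one, tsum_stepProb (fm.D_mem _ _) (fm.D_enabled _ _)] using this

theorem Scheduler.tsum_kernel (U : Scheduler N) (a : List (Conf Q C M) × Conf Q C M) :
    ∑' b, U.kernel a b = 1 := by
  have := U.tsum_kernel_mul a fun _ => 1
  simpa only [mul_one, tsum_stepProb (U.choose_mem _ _) (U.choose_enabled _ _)] using this

variable [Countable Q]

/-- The set of states with empty channels is almost surely visited. -/
theorem FMScheduler.avoidPr_eps (fm : FMScheduler N) (a : Conf Q C M × fm.Mode) :
    avoidPr fm.kernel {b | b.1.2 = eps C M} a = 0 := by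
  have := fm.modeFin
  have key := avoidPr_eq_zero_of_drift fm.tsum_kernel N.τ_pos N.τ_lt_one
    (fun b : Conf Q C M × fm.Mode => chansSize b.1.2) (fun a => ?_) (fun a => ?_) a
  · simpa only [chansSize_eq_zero] using key
  · rw [fm.tsum_kernel_mul a, tsum_stepProb_mul (fm.D_mem _ _) (fm.D_enabled _ _)]
    simp only
    rw [tsum_plost_size N.τ_pos N.τ_lt_one]
    gcongr
    exact_mod_cast chansSize_applyOp_le _ _
  · have h1 := fm.tsum_kernel_mul a fun t => if chansSize t.1.2 = 0 then 1 else 0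
    rw [tsum_stepProb_mul (fm.D_mem _ _) (fm.D_enabled _ _)] at h1
    simp only [mul_ite, mul_one, mul_zero] at h1
    rw [h1]
    refine le_trans ?_ (ENNReal.le_tsum (eps C M))
    rw [if_pos (chansSize_eq_zero.2 rfl), plost_eps N.τ_pos]
    exact pow_le_pow_right_of_le_one' (by simpa using N.τ_lt_one.le) (chansSize_applyOp_le _ _)

/-- Finite-memory chains revisit a set that stays reachable from the recurrent states with empty
channels. -/
theorem FMScheduler.avoidPr_eq_zero [Finite Q] (fm : FMScheduler N) {a : Conf Q C M × fm.Mode}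
    {G : Set (Conf Q C M × fm.Mode)}
    (h : ∀ y, fm.MCReach a y → y.1.2 = eps C M → ∃ g ∈ G, fm.MCReach y g)
    {s : Conf Q C M × fm.Mode} (hs : fm.MCReach a s) : avoidPr fm.kernel G s = 0 := by
  have := fm.modeFin
  let F : Set (Conf Q C M × fm.Mode) := {b | b.1.2 = eps C M}
  have hF : (F ∩ {y | fm.MCReach a y}).Finite := by
    refine Set.Finite.subset (Set.finite_range fun p : Q × fm.Mode => ((p.1, eps C M), p.2)) ?_
    rintro ⟨⟨z, w⟩, m⟩ ⟨hw, -⟩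
    exact ⟨(z, m), by rw [show w = eps C M from hw]⟩
  have hlt : ∀ y ∈ hF.toFinset, avoidPr fm.kernel G y < 1 := by
    intro y hy
    obtain ⟨hy1, hy2⟩ := hF.mem_toFinset.1 hy
    obtain ⟨g, hg, hyg⟩ := h y hy2 hy1
    exact avoidPr_lt_one fm.tsum_kernel hyg hg
  refine avoidPr_eq_zero_of_attractor fm.tsum_kernel (stepClosed_reach a)
    ((Finset.sup_lt_iff (by simp)).2 hlt) (F := F) (fun s _ => fm.avoidPr_eps s) ?_ s hs
  exact fun s hs hsF => Finset.le_sup (f := avoidPr fm.kernel G) (hF.mem_toFinset.2 ⟨hsF, hs⟩)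

theorem FMScheduler.infOften_compl_null [Finite Q] (fm : FMScheduler N)
    {a : Conf Q C M × fm.Mode} {G : Set (Conf Q C M × fm.Mode)}
    (h : ∀ y, fm.MCReach a y → y.1.2 = eps C M → ∃ g ∈ G, fm.MCReach y g) :
    chainPr fm.kernel a (evInfOften (· ∈ G))ᶜ = 0 := by
  have := fm.modeFin
  exact chainPr_evInfOften_compl fm.tsum_kernel (stepClosed_reach a)
    (fun s hs => fm.avoidPr_eq_zero h hs) Relation.ReflTransGen.refl

/-- The scheduler that runs the finite-memory data from mode `m`. -/
def FMScheduler.startAt (fm : FMScheduler N) (m : fm.Mode) : Scheduler N where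
  choose h s := fm.D (h.foldl fm.upd m) s
  choose_mem _ _ := fm.D_mem _ _
  choose_enabled _ _ := fm.D_enabled _ _

theorem FMScheduler.startAt_pr (fm : FMScheduler N) (m : fm.Mode) (s : Conf Q C M)
    {E : Set (ℕ → Conf Q C M)} (hE : MeasEv E) :
    (fm.startAt m).Pr s E = chainPr fm.kernel (s, m) {ω | (fun i => (ω i).1) ∈ E} := by
  have := fm.modeFin
  let f : List (Conf Q C M) × Conf Q C M → Conf Q C M × fm.Mode :=
    fun a => (a.2, a.1.foldl fm.upd m)
  refine (chainPr_map (fm.startAt m).tsum_kernel f (k' := fm.kernel) (fun a b => ?_) ([], s)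
    (hE.comp Prod.fst)).symm
  have h1 := (fm.startAt m).tsum_kernel_mul a fun t => if f t = b then 1 else 0
  simp only [mul_ite, mul_one, mul_zero] at h1
  refine Eq.trans ?_ (h1.symm.trans (tsum_congr fun t => by congr))
  rw [FMScheduler.kernel, tsum_eq_single b.1]
  · simp [f, Prod.ext_iff, eq_comm, FMScheduler.startAt]
  · intro t ht
    simp [f, Prod.ext_iff, ht]

/-- The scheduler that behaves as `W` after the history `h`. -/
def Scheduler.after (W : Scheduler N) (h : List (Conf Q C M)) : Scheduler N where
  choose h' s := W.choose (h ++ h') s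
  choose_mem _ _ := W.choose_mem _ _
  choose_enabled _ _ := W.choose_enabled _ _

theorem Scheduler.after_pr (W : Scheduler N) (h : List (Conf Q C M)) (s : Conf Q C M)
    {E : Set (ℕ → Conf Q C M)} (hE : MeasEv E) :
    (W.after h).Pr s E = chainPr W.kernel (h, s) {ω | (fun i => (ω i).2) ∈ E} := by
  let f : List (Conf Q C M) × Conf Q C M → List (Conf Q C M) × Conf Q C M :=
    fun a => (h ++ a.1, a.2)
  have hm := chainPr_map (W.after h).tsum_kernel f (k' := W.kernel) (fun a b => ?_) ([], s)
    (hE.comp Prod.snd)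
  · rw [show f ([], s) = (h, s) by simp [f]] at hm
    exact hm.symm
  have h1 := (W.after h).tsum_kernel_mul a fun t => if f t = b then 1 else 0
  simp only [mul_ite, mul_one, mul_zero] at h1
  refine Eq.trans ?_ (h1.symm.trans (tsum_congr fun t => by congr))
  rw [Scheduler.kernel, tsum_eq_single b.2]
  · simp [f, Prod.ext_iff, eq_comm, Scheduler.after]
  · intro t ht
    simp [f, Prod.ext_iff, ht]

theorem Scheduler.pr_eq_one_iff (W : Scheduler N) (s : Conf Q C M)
    {E : Set (ℕ → Conf Q C M)} (hE : MeasEv E) :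
    W.Pr s E = 1 ↔ chainPr W.kernel ([], s) {ω | (fun i => (ω i).2) ∈ E}ᶜ = 0 :=
  chainPr_eq_one_iff W.tsum_kernel (hE.comp Prod.snd)

end SchedulerChains

/-! ## From a finite-memory scheduler to the reachability objective -/

section Necessity

theorem reach_of_steps {S : Type} {k : S → S → ℝ≥0∞} {ω : ℕ → S}
    (h : ∀ i, 0 < k (ω i) (ω (i + 1))) (i : ℕ) :
    Relation.ReflTransGen (fun x y => 0 < k x y) (ω 0) (ω i) := by
  induction i with
  | zero => exact .refl
  | succ i ih => exact ih.tail (h i)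

theorem exists_steps_of_chainPr_null {S : Type} [Countable S] {k : S → S → ℝ≥0∞}
    (hk : ∀ s, ∑' t, k s t = 1) {s : S} {E : Set (ℕ → S)} (hE : chainPr k s E = 0) :
    ∃ ω, ω 0 = s ∧ (∀ i, 0 < k (ω i) (ω (i + 1))) ∧ ω ∉ E := by
  obtain ⟨ω, h0, hω⟩ := exists_of_chainPr_null hk
    (chainPr_union_null (chainPr_evAlways_step_compl hk s) hE)
  exact ⟨ω, h0, not_not.1 fun h => hω (Or.inl h), fun h => hω (Or.inr h)⟩

theorem chainPr_null_of_steps {S : Type} [Countable S] {k : S → S → ℝ≥0∞}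
    (hk : ∀ s, ∑' t, k s t = 1) {s : S} {E : Set (ℕ → S)}
    (h : ∀ ω, ω 0 = s → (∀ i, 0 < k (ω i) (ω (i + 1))) → ω ∉ E) : chainPr k s E = 0 := by
  refine le_antisymm ((chainPr_mono_start fun ω hω h0 => ?_).trans_eq
    (chainPr_evAlways_step_compl hk s)) zero_le
  exact fun hst => h ω h0 hst hω

/-- The locations from which some scheduler almost surely satisfies `□◇A ∧ □¬B`. -/
def NPLCS.winLoc {Q C M : Type} [Fintype C] [DecidableEq C] [DecidableEq M] (N : NPLCS Q C M)
    (A B : Set Q) : Set Q :=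
  {z | ∃ W : Scheduler N, W.Pr (z, eps C M)
    (evInfOften (inLoc A) ∩ evAlways (fun s : Conf Q C M => s.1 ∉ B)) = 1}

variable {Q C M : Type} [Fintype C] [DecidableEq C] [DecidableEq M] {N : NPLCS Q C M}
variable [Finite Q]

theorem FMScheduler.exists_minimal_eps (fm : FMScheduler N) {y : Conf Q C M × fm.Mode}
    (hy : y.1.2 = eps C M) : ∃ x, x.1.2 = eps C M ∧ fm.MCReach y x ∧
      ∀ x', x'.1.2 = eps C M → fm.MCReach x x' → fm.MCReach x' x := by
  have := fm.modeFin
  have hF : {b : Conf Q C M × fm.Mode | b.1.2 = eps C M ∧ fm.MCReach y b}.Finite := by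
    refine Set.Finite.subset (Set.finite_range fun p : Q × fm.Mode => ((p.1, eps C M), p.2)) ?_
    rintro ⟨⟨z, w⟩, m⟩ ⟨hw, -⟩
    exact ⟨(z, m), by rw [show w = eps C M from hw]⟩
  obtain ⟨x, ⟨hx, hyx⟩, hmin⟩ := Set.Finite.exists_minimalFor (fun x => {x' | fm.MCReach x x'}) _ hF
    ⟨y, hy, .refl⟩
  exact ⟨x, hx, hyx, fun x' hx' hxx' => @hmin x' ⟨hx', hyx.trans hxx'⟩
    (fun _ h => hxx'.trans h) x Relation.ReflTransGen.refl⟩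

variable [Countable M]

theorem FMScheduler.exists_reach_winLoc (fm : FMScheduler N) {n : ℕ} {A B : Fin n → Set Q}
    {y : Conf Q C M × fm.Mode} (hy : y.1.2 = eps C M)
    (hE : ∀ x, fm.MCReach y x → chainPr fm.kernel x
      (⋃ i, evInfOften (fun b : Conf Q C M × fm.Mode => b.1.1 ∈ A i) ∩
        evEvAlways (fun b : Conf Q C M × fm.Mode => b.1.1 ∉ B i))ᶜ = 0) :
    ∃ x, fm.MCReach y x ∧ x.1.1 ∈ ⋃ i, N.winLoc (A i) (B i) := by
  have := fm.modeFin
  obtain ⟨x, hx, hyx, hmin⟩ := fm.exists_minimal_eps hy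
  have hrec : ∀ D : Set Q, (∃ g, g.1.1 ∈ D ∧ fm.MCReach x g) →
      chainPr fm.kernel x (evInfOften fun b : Conf Q C M × fm.Mode => b.1.1 ∈ D)ᶜ = 0 := by
    rintro D ⟨g, hg, hxg⟩
    exact fm.infOften_compl_null (G := {b | b.1.1 ∈ D}) fun y hxy hy =>
      ⟨g, hg, (hmin y hy hxy).trans hxg⟩
  have hbad : chainPr fm.kernel x (⋃ i : {i // ∃ g, g.1.1 ∈ B i ∧ fm.MCReach x g},
      (evInfOften fun b : Conf Q C M × fm.Mode => b.1.1 ∈ B i)ᶜ) = 0 :=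
    chainPr_iUnion_null fun i => hrec _ i.2
  obtain ⟨ω, rfl, hst, hω⟩ := exists_steps_of_chainPr_null fm.tsum_kernel
    (chainPr_union_null (hE x hyx) hbad)
  simp only [Set.mem_union, Set.mem_compl_iff, not_or, not_not, Set.mem_iUnion] at hω
  obtain ⟨⟨i, hA, m, hm⟩, hB⟩ := hω
  replace hB : ∀ i : {i // ∃ g, g.1.1 ∈ B i ∧ fm.MCReach (ω 0) g},
      ω ∈ evInfOften fun b : Conf Q C M × fm.Mode => b.1.1 ∈ B i :=
    fun i => not_not.1 fun h => hB ⟨i, h⟩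
  have hB' : ∀ g, fm.MCReach (ω 0) g → g.1.1 ∉ B i := by
    intro g hg hgB
    obtain ⟨j, hmj, hj⟩ := hB ⟨i, g, hgB, hg⟩ m
    exact hm j hmj hj
  obtain ⟨j, -, hj⟩ := hA 0
  have hinf := hrec (A i) ⟨ω j, hj, reach_of_steps hst j⟩
  refine ⟨ω 0, hyx, Set.mem_iUnion.2 ⟨i, fm.startAt (ω 0).2, ?_⟩⟩
  have hmeas : MeasEv (evInfOften (inLoc (A i)) ∩ evAlways (fun s : Conf Q C M => s.1 ∉ B i)) :=
    (MeasEv.evInfOften _).inter (.evAlways _)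
  rw [← hx, fm.startAt_pr _ _ hmeas, chainPr_eq_one_iff fm.tsum_kernel (hmeas.comp Prod.fst)]
  have hsafe : chainPr fm.kernel (ω 0)
      (evAlways fun b : Conf Q C M × fm.Mode => b.1.1 ∉ B i)ᶜ = 0 :=
    chainPr_null_of_steps fm.tsum_kernel fun ω' h0 hst' hω' =>
      hω' fun j => hB' _ (h0 ▸ reach_of_steps hst' j)
  refine chainPr_null_mono (chainPr_union_null hinf hsafe) fun ω' hω' => ?_
  by_contra hcon
  simp only [Set.mem_union, Set.mem_compl_iff, not_or, not_not] at hcon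
  exact hω' hcon

theorem FMScheduler.eventually_winLoc (fm : FMScheduler N) {q : Q} {n : ℕ} {A B : Fin n → Set Q}
    (h : (fm.startAt fm.init).Pr (q, eps C M) (⋃ i, evInfOften (inLoc (A i)) ∩
      evEvAlways (fun s : Conf Q C M => s.1 ∉ B i)) = 1) :
    (fm.startAt fm.init).Pr (q, eps C M)
      (evEventually (inLoc (⋃ i, N.winLoc (A i) (B i)))) = 1 := by
  have := fm.modeFin
  have hmeas : MeasEv (⋃ i, evInfOften (inLoc (A i)) ∩
      evEvAlways (fun s : Conf Q C M => s.1 ∉ B i)) :=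
    .iUnion fun i => (MeasEv.evInfOften _).inter (.evEvAlways _)
  rw [fm.startAt_pr _ _ hmeas, chainPr_eq_one_iff fm.tsum_kernel (hmeas.comp Prod.fst)] at h
  have hE : ∀ x, fm.MCReach ((q, eps C M), fm.init) x → chainPr fm.kernel x
      (⋃ i, evInfOften (fun b : Conf Q C M × fm.Mode => b.1.1 ∈ A i) ∩
        evEvAlways (fun b : Conf Q C M × fm.Mode => b.1.1 ∉ B i))ᶜ = 0 := by
    intro x hx
    induction hx with
    | refl =>
      refine chainPr_null_mono h (Set.compl_subset_compl.2 fun ω hω => ?_)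
      obtain ⟨i, hi⟩ := Set.mem_iUnion.1 hω
      exact Set.mem_iUnion.2 ⟨i, hi⟩
    | tail _ hst ih =>
      refine chainPr_null_succ fm.tsum_kernel hst (MeasEv.iUnion fun i =>
        (MeasEv.evInfOften _).inter (.evEvAlways _)).compl ih fun ω hω hcon => hω ?_
      obtain ⟨i, hA, m, hm⟩ := Set.mem_iUnion.1 hcon
      refine Set.mem_iUnion.2 ⟨i, fun j => ?_, m, fun j hj => hm (j + 1) (by omega)⟩
      obtain ⟨_ | l, hl, hA'⟩ := hA (j + 1)
      · omega
      · exact ⟨l, by omega, hA'⟩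
  have hev : MeasEv (evEventually
      (inLoc (⋃ i, N.winLoc (A i) (B i)) : Conf Q C M → Prop)) := .evEventually _
  rw [fm.startAt_pr _ _ hev, chainPr_eq_one_iff fm.tsum_kernel (hev.comp Prod.fst)]
  refine chainPr_null_mono (fm.avoidPr_eq_zero
    (G := {b | b.1.1 ∈ ⋃ i, N.winLoc (A i) (B i)}) (fun y hy hyeps => ?_) .refl)
    fun ω hω i hi => hω ⟨i, hi⟩
  obtain ⟨x, hyx, hx⟩ := fm.exists_reach_winLoc hyeps fun x hx => hE x (hy.trans hx)
  exact ⟨x, hx, hyx⟩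

end Necessity

/-! ## From the reachability objective to a memoryless scheduler -/

section Sufficiency

variable {Q C M : Type} [DecidableEq C]

theorem stepVia_dst_eps {L : LCS Q C M} {s : Conf Q C M} {δ : LcsRule Q C M} (hδ : δ ∈ L.rules)
    (hs : δ.EnabledIn s) : L.StepVia s δ (δ.dst, eps C M) :=
  ⟨hδ, hs, rfl, fun _ => List.nil_sublist _⟩

/-- `hit ρ T i k` contains the configurations from which the locations that belong to `T` or have
`ρ`-value below `i` can be reached in `k` steps through locations with `ρ`-value at most `i`. -/
def LCS.hit (L : LCS Q C M) (ρ : Q → ℕ) (T : Set Q) (i : ℕ) : ℕ → Set (Conf Q C M)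
  | 0 => {t | t.1 ∈ T ∨ ρ t.1 < i}
  | k + 1 => {s | ∃ δ t, L.StepVia s δ t ∧ ρ t.1 ≤ i ∧ t ∈ LCS.hit L ρ T i k}

theorem LCS.exists_hit {L : LCS Q C M} {ρ : Q → ℕ} {T : Set Q} {i : ℕ} {s t : Conf Q C M}
    (h : Relation.ReflTransGen (fun a b => L.Step a b ∧ ρ b.1 ≤ i) s t)
    (ht : t.1 ∈ T ∨ ρ t.1 < i) : ∃ k, s ∈ L.hit ρ T i k := by
  induction h using Relation.ReflTransGen.head_induction_on with
  | refl => exact ⟨0, ht⟩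
  | head hst _ ih =>
    obtain ⟨k, hk⟩ := ih
    obtain ⟨⟨δ, hδ⟩, hρ⟩ := hst
    exact ⟨k + 1, δ, _, hδ, hρ, hk⟩

/-- Every configuration has an enabled rule that does not increase `ρ` and that decreases the
distance to the target. -/
theorem exists_rule_hit {L : LCS Q C M} {ρ : Q → ℕ} {T : ℕ → Set Q}
    (hS : ∀ z, ∃ δ ∈ L.rules, δ.src = z ∧ ¬ δ.op.IsRecv ∧ ρ δ.dst ≤ ρ z) (s : Conf Q C M) :
    ∃ δ ∈ L.rules, δ.EnabledIn s ∧ ρ δ.dst ≤ ρ s.1 ∧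
      ∀ k, s ∈ L.hit ρ (T (ρ s.1)) (ρ s.1) (k + 1) →
        (∀ j ≤ k, s ∉ L.hit ρ (T (ρ s.1)) (ρ s.1) j) →
        ∃ t, L.StepVia s δ t ∧ t ∈ L.hit ρ (T (ρ s.1)) (ρ s.1) k := by
  by_cases h : ∃ k, s ∈ L.hit ρ (T (ρ s.1)) (ρ s.1) (k + 1) ∧
      ∀ j ≤ k, s ∉ L.hit ρ (T (ρ s.1)) (ρ s.1) j
  · obtain ⟨k, ⟨δ, t, hδ, hρ, ht⟩, hk⟩ := h
    refine ⟨δ, hδ.1, hδ.2.1, hδ.2.2.1 ▸ hρ, fun k' hk' hlt => ?_⟩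
    have : k' = k := by
      rcases lt_trichotomy k k' with hlt' | rfl | hlt'
      · exact absurd ⟨δ, t, hδ, hρ, ht⟩ (hlt (k + 1) hlt')
      · rfl
      · exact absurd hk' (hk (k' + 1) hlt')
    exact ⟨t, hδ, this ▸ ht⟩
  · obtain ⟨δ, hδ, hsrc, hrecv, hρ⟩ := hS s.1
    exact ⟨δ, hδ, enabledIn_of_not_isRecv hsrc hrecv, hρ, fun k hk hlt => absurd ⟨k, hk, hlt⟩ h⟩

variable [Fintype C] [DecidableEq M] {N : NPLCS Q C M}

/-- The locations from which some scheduler almost surely satisfies `E`. -/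
def NPLCS.sureLoc (N : NPLCS Q C M) (E : Set (ℕ → Conf Q C M)) : Set Q :=
  {z | ∃ W : Scheduler N, W.Pr (z, eps C M) E = 1}

variable [Countable M]

theorem mem_sureLoc_of_null [Countable Q] {E : Set (ℕ → Conf Q C M)} (hE : MeasEv E)
    {W : Scheduler N} {h : List (Conf Q C M)} {z : Q}
    (hnull : chainPr W.kernel (h, (z, eps C M)) {ω | (fun i => (ω i).2) ∈ E}ᶜ = 0) :
    z ∈ N.sureLoc E :=
  ⟨W.after h, by
    rwa [W.after_pr h _ hE, chainPr_eq_one_iff W.tsum_kernel (hE.comp Prod.snd)]⟩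

theorem kernel_null_succ [Countable Q] {E : Set (ℕ → Conf Q C M)} (hE : MeasEv E) {G : Set Q}
    (hcons : ∀ s ω, s.1 ∉ G → consTraj s ω ∈ E → ω ∈ E) {W : Scheduler N}
    {x y : List (Conf Q C M) × Conf Q C M} (hxy : 0 < W.kernel x y) (hx : x.2.1 ∉ G)
    (hnull : chainPr W.kernel x {ω | (fun i => (ω i).2) ∈ E}ᶜ = 0) :
    chainPr W.kernel y {ω | (fun i => (ω i).2) ∈ E}ᶜ = 0 := by
  refine chainPr_null_succ W.tsum_kernel hxy (hE.comp Prod.snd).compl hnull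
    fun ω hω hcon => hω (hcons x.2 _ hx ?_)
  have : consTraj x.2 (fun i => (ω i).2) = fun i => (consTraj x ω i).2 := by
    funext i; cases i <;> rfl
  rw [this]
  exact hcon

theorem dst_mem_sureLoc [Countable Q] {E : Set (ℕ → Conf Q C M)} (hE : MeasEv E) {G : Set Q}
    (hcons : ∀ s ω, s.1 ∉ G → consTraj s ω ∈ E → ω ∈ E) {W : Scheduler N}
    {x : List (Conf Q C M) × Conf Q C M} (hx : x.2.1 ∉ G)
    (hnull : chainPr W.kernel x {ω | (fun i => (ω i).2) ∈ E}ᶜ = 0) :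
    (W.choose x.1 x.2).dst ∈ N.sureLoc E :=
  mem_sureLoc_of_null hE (kernel_null_succ hE hcons (Scheduler.kernel_pos_iff.2
    ⟨rfl, stepVia_dst_eps (W.choose_mem _ _) (W.choose_enabled _ _)⟩) hx hnull)

theorem exists_rule_sureLoc [Countable Q] {E : Set (ℕ → Conf Q C M)} (hE : MeasEv E) {G : Set Q}
    (hcons : ∀ s ω, s.1 ∉ G → consTraj s ω ∈ E → ω ∈ E) {z : Q} (hz : z ∈ N.sureLoc E)
    (hzG : z ∉ G) : ∃ δ ∈ N.L.rules, δ.src = z ∧ ¬ δ.op.IsRecv ∧ δ.dst ∈ N.sureLoc E := by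
  obtain ⟨W, hW⟩ := hz
  rw [W.pr_eq_one_iff _ hE] at hW
  exact ⟨_, W.choose_mem [] (z, eps C M), (W.choose_enabled _ _).1,
    not_isRecv_of_enabledIn_eps (W.choose_enabled _ _),
      dst_mem_sureLoc hE hcons (x := ([], (z, eps C M))) hzG hW⟩

theorem exists_path_of_null [Countable Q] {E : Set (ℕ → Conf Q C M)} (hE : MeasEv E)
    {G G' : Set Q} (hcons : ∀ s ω, s.1 ∉ G → consTraj s ω ∈ E → ω ∈ E) (hG : G ⊆ G')
    {W : Scheduler N} (j : ℕ) (ω : ℕ → List (Conf Q C M) × Conf Q C M)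
    (hst : ∀ i, 0 < W.kernel (ω i) (ω (i + 1))) (hj : (ω j).2.1 ∈ G')
    (hnull : chainPr W.kernel (ω 0) {ω | (fun i => (ω i).2) ∈ E}ᶜ = 0) :
    ∃ t, t.1 ∈ G' ∧
      Relation.ReflTransGen (fun a b => N.L.Step a b ∧ b.1 ∈ N.sureLoc E) (ω 0).2 t := by
  induction j generalizing ω with
  | zero => exact ⟨_, hj, .refl⟩
  | succ j ih =>
    by_cases hmem : (ω 0).2.1 ∈ G'
    · exact ⟨_, hmem, .refl⟩
    · have hnG : (ω 0).2.1 ∉ G := fun h => hmem (hG h)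
      have hnull' := kernel_null_succ hE hcons (hst 0) hnG hnull
      obtain ⟨t, ht, hpath⟩ := ih (fun i => ω (i + 1)) (fun i => hst (i + 1)) hj hnull'
      have hstep := (Scheduler.kernel_pos_iff.1 (hst 0)).2
      have hdst : (ω 1).2.1 ∈ N.sureLoc E := by
        rw [hstep.2.2.1]
        exact dst_mem_sureLoc hE hcons hnG hnull
      exact ⟨t, ht, hpath.head ⟨⟨_, hstep⟩, hdst⟩⟩

theorem exists_path_sureLoc [Countable Q] {E : Set (ℕ → Conf Q C M)} (hE : MeasEv E)
    {G G' : Set Q} (hcons : ∀ s ω, s.1 ∉ G → consTraj s ω ∈ E → ω ∈ E) (hG : G ⊆ G')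
    (hev : E ⊆ evEventually (inLoc G')) {z : Q} (hz : z ∈ N.sureLoc E) :
    ∃ t, t.1 ∈ G' ∧
      Relation.ReflTransGen (fun a b => N.L.Step a b ∧ b.1 ∈ N.sureLoc E) (z, eps C M) t := by
  obtain ⟨W, hW⟩ := hz
  rw [W.pr_eq_one_iff _ hE] at hW
  obtain ⟨ω, h0, hst, hω⟩ := exists_steps_of_chainPr_null W.tsum_kernel hW
  obtain ⟨j, hj⟩ := hev (not_not.1 hω)
  obtain ⟨t, ht, hpath⟩ := exists_path_of_null hE hcons hG j ω hst hj (by rw [h0]; exact hW)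
  rw [h0] at hpath
  exact ⟨t, ht, hpath⟩

variable [Finite Q]

/-- A memoryless scheduler that never increases `ρ` and keeps aiming at `T i` while `ρ = i`. -/
theorem exists_scheduler_of_rank {ρ : Q → ℕ} {T : ℕ → Set Q} {n : ℕ}
    (hS : ∀ z, ∃ δ ∈ N.L.rules, δ.src = z ∧ ¬ δ.op.IsRecv ∧ ρ δ.dst ≤ ρ z)
    (hP : ∀ z, ρ z ≤ n → ∃ t, (t.1 ∈ T (ρ z) ∨ ρ t.1 < ρ z) ∧
      Relation.ReflTransGen (fun a b => N.L.Step a b ∧ ρ b.1 ≤ ρ z) (z, eps C M) t)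
    {q : Q} (hq : ρ q ≤ n) {E : Set (ℕ → Conf Q C M)} (hE : MeasEv E)
    (hsub : ∀ ω : ℕ → Conf Q C M, ∀ i ≤ n, ω ∈ evEvAlways (fun s => ρ s.1 = i) →
      ω ∈ evInfOften (inLoc (T i)) → ω ∈ E) :
    ∃ U : Scheduler N, U.FiniteMemory ∧ U.Pr (q, eps C M) E = 1 := by
  choose D hD hDen hDρ hDhit using exists_rule_hit (L := N.L) (T := T) hS
  let fm : FMScheduler N :=
    { Mode := Unit, modeFin := inferInstance, init := (), D := fun _ => D, upd := fun _ _ => ()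
      D_mem := fun _ => hD, D_enabled := fun _ => hDen }
  have := fm.modeFin
  let G : ℕ → Set (Conf Q C M × fm.Mode) := fun i => {b | ρ b.1.1 = i → b.1.1 ∈ T i}
  have hmin : ∀ k, ∀ b : Conf Q C M × fm.Mode,
      b.1 ∈ N.L.hit ρ (T (ρ b.1.1)) (ρ b.1.1) k → ∃ g ∈ G (ρ b.1.1), fm.MCReach b g := by
    intro k
    induction k using Nat.strong_induction_on with
    | _ k ih =>
      intro b hb
      by_cases hlt : ∃ j < k, b.1 ∈ N.L.hit ρ (T (ρ b.1.1)) (ρ b.1.1) j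
      · obtain ⟨j, hj, hbj⟩ := hlt
        exact ih j hj b hbj
      cases k with
      | zero => exact ⟨b, fun _ => hb.resolve_right (lt_irrefl _), .refl⟩
      | succ k =>
        obtain ⟨t, hst, ht⟩ := hDhit b.1 k hb fun j hj hbj => hlt ⟨j, by omega, hbj⟩
        have hstep : 0 < fm.kernel b (t, ()) := FMScheduler.kernel_pos_iff.2 ⟨rfl, hst⟩
        by_cases hρ : ρ t.1 = ρ b.1.1
        · obtain ⟨g, hg, hreach⟩ := ih k (by omega) (t, ()) (by simpa only [hρ] using ht)
          exact ⟨g, by simpa only [hρ] using hg, hreach.head hstep⟩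
        · exact ⟨(t, ()), fun h => absurd h hρ, .single hstep⟩
  have hG : ∀ i ≤ n, chainPr fm.kernel ((q, eps C M), ()) (evInfOften (· ∈ G i))ᶜ = 0 := by
    intro i hi
    refine fm.infOften_compl_null fun y _ hy => ?_
    by_cases hρ : ρ y.1.1 = i
    · subst hρ
      obtain ⟨t, ht, hpath⟩ := hP y.1.1 hi
      obtain ⟨k, hk⟩ := LCS.exists_hit hpath ht
      rw [← hy] at hk
      exact hmin k y hk
    · exact ⟨y, fun h => absurd h hρ, .refl⟩
  have hnull : chainPr fm.kernel ((q, eps C M), ()) {ω | (fun i => (ω i).1) ∈ E}ᶜ = 0 := by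
    refine chainPr_null_mono (chainPr_union_null (chainPr_evAlways_step_compl fm.tsum_kernel _)
      (chainPr_union_null (chainPr_null_of_start (E := {ω | ω 0 ≠ ((q, eps C M), ())})
        fun _ h => h) (chainPr_iUnion_null fun i : {i // i ≤ n} => hG i i.2))) fun ω hω => ?_
    by_contra hcon
    simp only [Set.mem_union, not_or, Set.mem_iUnion, Set.mem_compl_iff, not_not, not_exists,
      Set.mem_ofPred_eq] at hcon
    obtain ⟨hst, h0, hinf⟩ := hcon
    replace h0 : ω 0 = ((q, eps C M), ()) := not_not.1 h0
    have hanti : Antitone fun j => ρ (ω j).1.1 := antitone_nat_of_succ_le fun j => by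
      have := (FMScheduler.kernel_pos_iff.1 (hst j)).2.2.2.1
      rw [this]
      exact hDρ _
    obtain ⟨_, ⟨m, rfl⟩, hm⟩ := WellFounded.has_min (wellFounded_lt (α := ℕ))
      (Set.range fun j => ρ (ω j).1.1) (Set.range_nonempty _)
    have hconst : ∀ j, m ≤ j → ρ (ω j).1.1 = ρ (ω m).1.1 := fun j hj =>
      le_antisymm (hanti hj) (not_lt.1 (hm _ ⟨j, rfl⟩))
    have hle : ρ (ω m).1.1 ≤ n := (hanti (Nat.zero_le m)).trans (by simpa only [h0] using hq)
    refine hω (hsub _ _ hle ⟨m, hconst⟩ fun l => ?_)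
    obtain ⟨j, hj, hjG⟩ := hinf ⟨_, hle⟩ (max l m)
    exact ⟨j, (le_max_left _ _).trans hj, hjG (hconst j ((le_max_right _ _).trans hj))⟩
  refine ⟨fm.startAt (), ⟨fm, fun h s => rfl⟩, ?_⟩
  rwa [fm.startAt_pr _ _ hE, chainPr_eq_one_iff fm.tsum_kernel (hE.comp Prod.fst)]

end Sufficiency

section Ranking

variable {Q C M : Type} [Fintype C] [DecidableEq C] [DecidableEq M] (N : NPLCS Q C M)

/-- The levels of the ranking used by the memoryless scheduler: the winning sets of the objectives,
then the locations from which these can be reached almost surely, then everything. -/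
def NPLCS.level {n : ℕ} (A B : Fin n → Set Q) (i : ℕ) : Set Q :=
  if h : i < n then N.winLoc (A ⟨i, h⟩) (B ⟨i, h⟩)
  else if i = n then
    N.sureLoc (evEventually (inLoc (⋃ j, N.winLoc (A j) (B j)) : Conf Q C M → Prop))
  else Set.univ

theorem NPLCS.exists_level {n : ℕ} (A B : Fin n → Set Q) (z : Q) : ∃ i, z ∈ N.level A B i :=
  ⟨n + 1, by simp [NPLCS.level]⟩

/-- The rank of a location is the first level that contains it. -/
noncomputable def NPLCS.rank {n : ℕ} (A B : Fin n → Set Q) (z : Q) : ℕ :=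
  Nat.find (N.exists_level A B z)

variable {N} {n : ℕ} {A B : Fin n → Set Q}

theorem NPLCS.mem_level_rank (z : Q) : z ∈ N.level A B (N.rank A B z) :=
  Nat.find_spec (N.exists_level A B z)

theorem NPLCS.rank_le {z : Q} {i : ℕ} (h : z ∈ N.level A B i) : N.rank A B z ≤ i :=
  Nat.find_min' _ h

theorem NPLCS.level_of_lt {i : ℕ} (h : i < n) :
    N.level A B i = N.sureLoc (evInfOften (inLoc (A ⟨i, h⟩)) ∩
      evAlways (fun s : Conf Q C M => s.1 ∉ B ⟨i, h⟩)) := by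
  rw [NPLCS.level, dif_pos h]
  rfl

theorem NPLCS.level_self : N.level A B n =
    N.sureLoc (evEventually (inLoc (⋃ j, N.winLoc (A j) (B j)) : Conf Q C M → Prop)) := by
  rw [NPLCS.level, dif_neg (lt_irrefl n), if_pos rfl]

theorem NPLCS.rank_lt_of_mem {z : Q} (h : z ∈ ⋃ j, N.winLoc (A j) (B j)) : N.rank A B z < n := by
  obtain ⟨j, hj⟩ := Set.mem_iUnion.1 h
  refine (NPLCS.rank_le ?_).trans_lt j.2
  rw [NPLCS.level, dif_pos j.2]
  exact hj

theorem consTraj_mem_recurrence {S : Type} {P R : S → Prop} {s : S} {ω : ℕ → S}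
    (h : consTraj s ω ∈ evInfOften P ∩ evAlways R) : ω ∈ evInfOften P ∩ evAlways R := by
  refine ⟨fun j => ?_, fun i => h.2 (i + 1)⟩
  obtain ⟨_ | l, hl, hP⟩ := h.1 (j + 1)
  · omega
  · exact ⟨l, by omega, hP⟩

theorem consTraj_mem_evEventually {S : Type} {P : S → Prop} {s : S} {ω : ℕ → S} (hs : ¬ P s)
    (h : consTraj s ω ∈ evEventually P) : ω ∈ evEventually P := by
  obtain ⟨_ | l, hP⟩ := h
  · exact absurd hP hs
  · exact ⟨l, hP⟩

variable [Countable M]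

theorem not_mem_of_mem_winLoc [Countable Q] {A B : Set Q} {z : Q} (hz : z ∈ N.winLoc A B) :
    z ∉ B := by
  obtain ⟨W, hW⟩ := hz
  rw [W.pr_eq_one_iff _ ((MeasEv.evInfOften _).inter (.evAlways _))] at hW
  obtain ⟨ω, h0, hω⟩ := exists_of_chainPr_null W.tsum_kernel hW
  have := (not_not.1 hω).2 0
  simpa only [h0] using this

theorem NPLCS.exists_rule_rank [Countable Q] (z : Q) : ∃ δ ∈ N.L.rules,
    δ.src = z ∧ ¬ δ.op.IsRecv ∧ N.rank A B δ.dst ≤ N.rank A B z := by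
  have hz := N.mem_level_rank (A := A) (B := B) z
  generalize hr : N.rank A B z = r at hz
  rcases lt_trichotomy r n with h | rfl | h
  · rw [NPLCS.level_of_lt h] at hz
    obtain ⟨δ, hδ, hsrc, hrecv, hdst⟩ := exists_rule_sureLoc (G := ∅)
      ((MeasEv.evInfOften _).inter (.evAlways _)) (fun _ _ _ => consTraj_mem_recurrence) hz
      (Set.notMem_empty z)
    refine ⟨δ, hδ, hsrc, hrecv, NPLCS.rank_le ?_⟩
    rwa [NPLCS.level_of_lt h]
  · rw [NPLCS.level_self] at hz
    obtain ⟨δ, hδ, hsrc, hrecv, hdst⟩ := exists_rule_sureLoc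
      (G := ⋃ j, N.winLoc (A j) (B j)) (MeasEv.evEventually _)
      (fun _ _ hs => consTraj_mem_evEventually hs) hz
      fun h => (NPLCS.rank_lt_of_mem h).ne hr
    refine ⟨δ, hδ, hsrc, hrecv, NPLCS.rank_le ?_⟩
    rwa [NPLCS.level_self]
  · obtain ⟨δ, hδ, hsrc, hrecv⟩ := N.L.noDeadlock z
    refine ⟨δ, hδ, hsrc, hrecv, NPLCS.rank_le ?_⟩
    rw [NPLCS.level, dif_neg h.not_gt, if_neg h.ne']
    trivial

theorem NPLCS.exists_path_rank [Countable Q] {z : Q} (hzn : N.rank A B z ≤ n) :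
    ∃ t : Conf Q C M, ((∃ h : N.rank A B z < n, t.1 ∈ A ⟨_, h⟩) ∨
        N.rank A B t.1 < N.rank A B z) ∧
      Relation.ReflTransGen (fun a b => N.L.Step a b ∧ N.rank A B b.1 ≤ N.rank A B z)
        (z, eps C M) t := by
  have hz := N.mem_level_rank (A := A) (B := B) z
  generalize hr : N.rank A B z = r at hz hzn
  rcases hzn.lt_or_eq with h | rfl
  · rw [NPLCS.level_of_lt h] at hz
    obtain ⟨t, ht, hpath⟩ := exists_path_sureLoc (G := ∅) (G' := A ⟨r, h⟩)
      ((MeasEv.evInfOften _).inter (.evAlways _)) (fun _ _ _ => consTraj_mem_recurrence)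
      (Set.empty_subset _) (fun ω hω => (hω.1 0).imp fun _ => And.right) hz
    refine ⟨t, Or.inl ⟨h, ht⟩,
      Relation.ReflTransGen.mono (fun a b hab => ⟨hab.1, NPLCS.rank_le ?_⟩) _ _ hpath⟩
    rw [NPLCS.level_of_lt h]
    exact hab.2
  · rw [NPLCS.level_self] at hz
    obtain ⟨t, ht, hpath⟩ := exists_path_sureLoc (MeasEv.evEventually _)
      (fun _ _ hs => consTraj_mem_evEventually hs) subset_rfl subset_rfl hz
    refine ⟨t, Or.inr (NPLCS.rank_lt_of_mem ht),
      Relation.ReflTransGen.mono (fun a b hab => ⟨hab.1, NPLCS.rank_le ?_⟩) _ _ hpath⟩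
    rw [NPLCS.level_self]
    exact hab.2

theorem exists_scheduler_of_eventually_winLoc [Finite Q] {q : Q} {V : Scheduler N}
    (hV : V.Pr (q, eps C M) (evEventually (inLoc (⋃ i, N.winLoc (A i) (B i)))) = 1) :
    ∃ U : Scheduler N, U.FiniteMemory ∧ U.Pr (q, eps C M) (⋃ i, evInfOften (inLoc (A i)) ∩
      evEvAlways (fun s : Conf Q C M => s.1 ∉ B i)) = 1 := by
  have hq : N.rank A B q ≤ n := NPLCS.rank_le (by rw [NPLCS.level_self]; exact ⟨V, hV⟩)
  refine exists_scheduler_of_rank (ρ := N.rank A B) (T := fun i => {z | ∃ h : i < n, z ∈ A ⟨i, h⟩})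
    NPLCS.exists_rule_rank (fun z => NPLCS.exists_path_rank) hq
    (.iUnion fun i => (MeasEv.evInfOften _).inter (.evEvAlways _)) ?_
  rintro ω i - ⟨m, hm⟩ hinf
  obtain ⟨_, -, hi, -⟩ := hinf 0
  refine Set.mem_iUnion.2 ⟨⟨i, hi⟩, fun j => ?_, m, fun j hj => ?_⟩
  · obtain ⟨l, hl, _, hlA⟩ := hinf j
    exact ⟨l, hl, hlA⟩
  · have := N.mem_level_rank (A := A) (B := B) (ω j).1
    rw [hm j hj, NPLCS.level, dif_pos hi] at this
    exact not_mem_of_mem_winLoc this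

end Ranking

/-- With `Cᵢ` the set of locations from which some scheduler satisfies
`□◇Aᵢ ∧ □¬Bᵢ` almost surely, and `C = C₁ ∪ ⋯ ∪ Cₙ`: some finite-memory
scheduler satisfies `⋁ᵢ (□◇Aᵢ ∧ ◇□¬Bᵢ)` almost surely from `(q,ε)` iff some
scheduler satisfies `◇C` almost surely. -/
theorem statement18 {Q C M : Type} [Fintype Q] [Fintype C] [DecidableEq C]
    [Fintype M] [DecidableEq M] (N : NPLCS Q C M) (q : Q) (n : ℕ)
    (A B : Fin n → Set Q) :
    (∃ U : Scheduler N, U.FiniteMemory ∧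
        U.Pr (q, eps C M)
          (⋃ i, evInfOften (inLoc (A i)) ∩
            evEvAlways (fun s : Conf Q C M => s.1 ∉ B i)) = 1)
    ↔ (∃ V : Scheduler N,
        V.Pr (q, eps C M) (evEventually (inLoc
          (⋃ i, {z : Q | ∃ W : Scheduler N,
            W.Pr (z, eps C M)
              (evInfOften (inLoc (A i)) ∩
                evAlways (fun s : Conf Q C M => s.1 ∉ B i)) = 1}))) = 1) := by
  constructor
  · rintro ⟨U, ⟨fm, hfm⟩, hU⟩
    obtain rfl : U = fm.startAt fm.init := by
      cases U
      simp only [FMScheduler.startAt, Scheduler.mk.injEq]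
      exact funext fun h => funext (hfm h)
    exact ⟨_, fm.eventually_winLoc hU⟩
  · rintro ⟨V, hV⟩
    exact exists_scheduler_of_eventually_winLoc hV

end NPLCSmodel
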